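/- Let k ≥ 1 and n₁,...,n_k ≥ 2 with n = Σ n_i, and let 𝒢 = 𝒢₁ × ⋯ × 𝒢_k be a Cartesian product of graphs where each 𝒢_i is either the path P_{2^{n_i}} or the cycle C_{2^{n_i}}. Then the minimum wirelength of embedding Q_n into 𝒢 equals Σ_{i=1}^k ℒ_i, where ℒ_i = 2^{n−n_i}(3·2^{2n_i−3} − 2^{n_i−1}) if 𝒢_i is a cycle and ℒ_i = 2^{n−n_i}(2^{2n_i−1} − 2^{n_i−1}) if 𝒢_i is a path; moreover the k-order Gray code embedding ξ_{n₁...n_k} achieves this minimum. -/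

import Mathlib

open Finset

/-- Number of coordinates in which two 0-1 vectors differ. -/
def diffCount {n : ℕ} (u v : Fin n → Bool) : ℕ :=
  (Finset.univ.filter fun i => u i ≠ v i).card

/-- Adjacency in the hypercube `Q_n`: differ in exactly one coordinate. -/
def cubeAdj {n : ℕ} (u v : Fin n → Bool) : Prop := diffCount u v = 1

instance {n : ℕ} (u v : Fin n → Bool) : Decidable (cubeAdj u v) :=
  inferInstanceAs (Decidable (diffCount u v = 1))

/-- `theta n S`: number of edges of `Q_n` with exactly one endpoint in `S`. -/
def theta (n : ℕ) (S : Finset (Fin n → Bool)) : ℕ :=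
  ((Finset.univ ×ˢ Finset.univ).filter fun p : (Fin n → Bool) × (Fin n → Bool) =>
    p.1 ∈ S ∧ p.2 ∉ S ∧ cubeAdj p.1 p.2).card

/-- The reflected Gray code map `ξ_n : {0,1}^n → {1,...,2^n}`. -/
def gray : (n : ℕ) → (Fin n → Bool) → ℕ
  | 0, _ => 1
  | n + 1, v =>
    if v 0 = false then gray n (fun i => v i.succ)
    else 2 ^ (n + 1) + 1 - gray n (fun i => v i.succ)

/-- Wirelength of an embedding `f` of `Q_n` into a host with distance `d`. -/
def wirelength {n : ℕ} {α : Type*} (d : α → α → ℕ) (f : (Fin n → Bool) → α) : ℕ :=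
  (∑ u : Fin n → Bool, ∑ v : Fin n → Bool, if cubeAdj u v then d (f u) (f v) else 0) / 2

/-- Cyclic distance on the cycle with `m` vertices labeled `1,...,m`. -/
def cycDist (m a b : ℕ) : ℕ := min (Nat.dist a b) (m - Nat.dist a b)

/-- The 2-order Gray code map. -/
def gray2 (n₁ n₂ : ℕ) (v : Fin (n₁ + n₂) → Bool) : ℕ × ℕ :=
  (gray n₁ fun i => v (Fin.castAdd n₂ i), gray n₂ fun i => v (Fin.natAdd n₁ i))
/-- Offset of the `i`-th block in the concatenation of blocks of sizes `n j`. -/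
def blockOffset {k : ℕ} (n : Fin k → ℕ) (i : Fin k) : ℕ :=
  ∑ j ∈ Finset.univ.filter (fun j => j < i), n j

lemma blockPos_lt {k : ℕ} (n : Fin k → ℕ) (i : Fin k) (t : Fin (n i)) :
    blockOffset n i + (t : ℕ) < ∑ j, n j := by
  have ht : (t : ℕ) < n i := t.isLt
  calc blockOffset n i + (t : ℕ) < blockOffset n i + n i := by omega
    _ = ∑ j ∈ insert i (Finset.univ.filter (fun j => j < i)), n j := by
        rw [Finset.sum_insert (by simp), Nat.add_comm]; rfl
    _ ≤ ∑ j, n j := Finset.sum_le_sum_of_subset (Finset.subset_univ _)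

/-- The position in `Fin (∑ j, n j)` of the `t`-th coordinate of the `i`-th block. -/
def blockPos {k : ℕ} (n : Fin k → ℕ) (i : Fin k) (t : Fin (n i)) : Fin (∑ j, n j) :=
  ⟨blockOffset n i + (t : ℕ), blockPos_lt n i t⟩

/-- The `i`-th block of a concatenated 0-1 vector. -/
def block {k : ℕ} (n : Fin k → ℕ) (v : Fin (∑ j, n j) → Bool) (i : Fin k) :
    Fin (n i) → Bool :=
  fun t => v (blockPos n i t)

/-- Splitting map realizing the identification `{0,1}^n ≅ ∏ {0,1}^{n_i}`. -/
def split {k : ℕ} (n : Fin k → ℕ) (v : Fin (∑ j, n j) → Bool) :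
    (i : Fin k) → Fin (n i) → Bool :=
  fun i => block n v i

/-- The `k`-order Gray code map `ξ_{n₁…n_k}`. -/
def grayK {k : ℕ} (n : Fin k → ℕ) (v : Fin (∑ j, n j) → Bool) : Fin k → ℕ :=
  fun i => gray (n i) (block n v i)

/-- Graph distance in the Cartesian product of paths/cycles: `c i = true` means the
`i`-th factor is the cycle `C_{2^{n_i}}`, `c i = false` means the path `P_{2^{n_i}}`. -/
def prodDist {k : ℕ} (c : Fin k → Bool) (n : Fin k → ℕ) (x y : Fin k → ℕ) : ℕ :=
  ∑ i, if c i then cycDist (2 ^ n i) (x i) (y i) else Nat.dist (x i) (y i)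

/-- The minimal size of the edge boundary of an `i`-element vertex set of the `n`-cube: a
discrete Takagi function. -/
def takagi : ℕ → ℕ → ℕ
  | 0, _ => 0
  | n + 1, i =>
    if i ≤ 2 ^ n then i + takagi n i else (2 ^ (n + 1) - i) + takagi n (2 ^ (n + 1) - i)

lemma takagi_succ_of_le {n i : ℕ} (h : i ≤ 2 ^ n) : takagi (n + 1) i = i + takagi n i := by
  simp [takagi, h]

lemma takagi_symm {n i : ℕ} (h : i ≤ 2 ^ n) : takagi n (2 ^ n - i) = takagi n i := by
  cases n with
  | zero => rfl
  | succ n =>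
    have h2 : 2 ^ (n + 1) = 2 * 2 ^ n := by ring
    rcases lt_trichotomy i (2 ^ n) with hi | hi | hi
    · have e : 2 ^ (n + 1) - (2 ^ (n + 1) - i) = i := by omega
      rw [takagi_succ_of_le hi.le, takagi, if_neg (by omega), e]
    · have e : 2 ^ (n + 1) - i = i := by omega
      rw [e]
    · rw [takagi_succ_of_le (by omega), takagi, if_neg (by omega)]

lemma takagi_zero_right (n : ℕ) : takagi n 0 = 0 := by
  induction n with
  | zero => rfl
  | succ n ih => simp [takagi_succ_of_le, ih]

lemma two_pow_le_takagi {n i : ℕ} (h₁ : 2 ^ n ≤ i) (h₂ : i ≤ 3 * 2 ^ n) :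
    2 ^ (n + 1) ≤ takagi (n + 2) i := by
  have key : ∀ j, 2 ^ n ≤ j → j ≤ 2 ^ (n + 1) → 2 ^ (n + 1) ≤ takagi (n + 2) j := by
    intro j h₁ h₂
    rw [takagi_succ_of_le h₂, ← takagi_symm h₂, takagi_succ_of_le]
    · omega
    · rw [pow_succ] at *; omega
  have e₁ : 2 ^ (n + 1) = 2 * 2 ^ n := by ring
  have e₂ : 2 ^ (n + 2) = 4 * 2 ^ n := by ring
  by_cases h : i ≤ 2 ^ (n + 1)
  · exact key i h₁ h
  · rw [← takagi_symm (by omega)]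
    exact key _ (by omega) (by omega)

lemma takagi_add_le_aux (n : ℕ) :
    (∀ a b, a ≤ 2 ^ n → b ≤ 2 ^ n → b ≤ a →
      takagi (n + 1) (a + b) ≤ takagi n a + takagi n b + (a - b)) ∧
    (∀ a b, a + b ≤ 2 ^ n → takagi n (a + b) ≤ takagi n a + takagi n b) := by
  induction n with
  | zero =>
    refine ⟨fun a b ha hb hab => ?_, fun a b hab => by simp [takagi]⟩
    simp only [pow_zero] at ha hb
    interval_cases a <;> interval_cases b <;> simp_all [takagi]
  | succ n ih =>
    obtain ⟨ih₁, ih₂⟩ := ih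
    have e₁ : 2 ^ (n + 1) = 2 * 2 ^ n := by ring
    have e₂ : 2 ^ (n + 2) = 4 * 2 ^ n := by ring
    have diff : ∀ p b, b ≤ p → p ≤ 2 ^ n → takagi n (p - b) ≤ takagi n p + takagi n b := by
      intro p b hbp hp
      have := ih₂ (2 ^ n - p) b (by omega)
      rw [takagi_symm hp] at this
      rw [← takagi_symm (by omega)]
      convert this using 2
      omega
    have main : ∀ a b, a + b ≤ 2 ^ (n + 1) → b ≤ a →
        takagi (n + 2) (a + b) ≤ takagi (n + 1) a + takagi (n + 1) b + (a - b) := by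
      intro a b hab hba
      by_cases ha : a ≤ 2 ^ n
      · rw [takagi_succ_of_le hab, takagi_succ_of_le ha, takagi_succ_of_le (hba.trans ha)]
        have := ih₁ a b ha (hba.trans ha) hba
        omega
      · have h₁ := diff (2 ^ (n + 1) - a) b (by omega) (by omega)
        rw [takagi_succ_of_le hab, ← takagi_symm hab, takagi_succ_of_le (by omega),
          ← takagi_symm (n := n + 1) (i := a) (by omega),
          takagi_succ_of_le (i := 2 ^ (n + 1) - a) (by omega),
          takagi_succ_of_le (i := b) (by omega)]
        rw [Nat.sub_sub] at h₁
        omega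
    refine ⟨fun a b ha hb hba => ?_, fun a b hab => ?_⟩
    · by_cases hab : a + b ≤ 2 ^ (n + 1)
      · exact main a b hab hba
      · have := main (2 ^ (n + 1) - b) (2 ^ (n + 1) - a) (by omega) (by omega)
        rw [takagi_symm ha, takagi_symm hb] at this
        rw [← takagi_symm (by omega)]
        have e : 2 ^ (n + 1 + 1) - (a + b) = 2 ^ (n + 1) - b + (2 ^ (n + 1) - a) := by omega
        rw [e, show n + 1 + 1 = n + 2 from rfl]
        omega
    · wlog hba : b ≤ a generalizing a b
      · have := this b a (by omega) (by omega)
        rwa [add_comm b a, add_comm (takagi _ b)] at this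
      by_cases ha : a ≤ 2 ^ n
      · rw [takagi_succ_of_le ha, takagi_succ_of_le (hba.trans ha)]
        have := ih₁ a b ha (hba.trans ha) hba
        omega
      · have h₁ := diff (2 ^ (n + 1) - a) b (by omega) (by omega)
        rw [← takagi_symm hab, ← takagi_symm (n := n + 1) (i := a) (by omega),
          takagi_succ_of_le (i := 2 ^ (n + 1) - a) (by omega),
          takagi_succ_of_le (i := b) (by omega), takagi_succ_of_le (by omega)]
        rw [Nat.sub_sub] at h₁
        omega

/-- The inequality behind the edge-isoperimetric inequality of the cube. -/
lemma takagi_add_le {n a b : ℕ} (ha : a ≤ 2 ^ n) (hb : b ≤ 2 ^ n) :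
    (takagi (n + 1) (a + b) : ℤ) ≤ takagi n a + takagi n b + |(a : ℤ) - b| := by
  rcases le_total b a with h | h
  · have := (takagi_add_le_aux n).1 a b ha hb h
    rw [abs_of_nonneg (by omega)]
    omega
  · have := (takagi_add_le_aux n).1 b a hb ha h
    rw [abs_of_nonpos (by omega), add_comm a b]
    omega

/-- The sum of `takagi n` over the integers in `(-i, i]`. -/
def takagiWindow (n i : ℕ) : ℕ := 2 * ∑ j ∈ range i, takagi n j + takagi n i

lemma takagiWindow_succ_right (n i : ℕ) :
    takagiWindow n (i + 1) = takagiWindow n i + (takagi n i + takagi n (i + 1)) := by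
  simp only [takagiWindow, sum_range_succ]
  ring

lemma takagiWindow_zero_right (n : ℕ) : takagiWindow n 0 = 0 := by
  simp [takagiWindow, takagi_zero_right]

lemma takagiWindow_succ_left {n i : ℕ} (h : i ≤ 2 ^ n) :
    takagiWindow (n + 1) i = takagiWindow n i + i ^ 2 := by
  induction i with
  | zero => simp [takagiWindow_zero_right]
  | succ i ih =>
    rw [takagiWindow_succ_right, takagiWindow_succ_right, ih (by omega),
      takagi_succ_of_le (by omega), takagi_succ_of_le h]
    ring

lemma sum_takagi_eq_window (n : ℕ) :
    ∑ j ∈ range (2 ^ (n + 1)), takagi (n + 1) j = takagiWindow (n + 1) (2 ^ n) := by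
  have e₁ : 2 ^ (n + 1) = 2 ^ n + 2 ^ n := by ring
  have h : ∑ j ∈ range (2 ^ n), takagi (n + 1) (2 ^ n + j)
      = ∑ j ∈ range (2 ^ n), takagi (n + 1) (j + 1) := by
    rw [← sum_range_reflect]
    refine sum_congr rfl fun j hj => ?_
    rw [mem_range] at hj
    rw [← takagi_symm (by omega)]
    congr 1
    omega
  have h₂ := sum_range_succ' (takagi (n + 1)) (2 ^ n)
  rw [sum_range_succ, takagi_zero_right] at h₂
  rw [takagiWindow, e₁, sum_range_add, h]
  omega

lemma sum_takagi (n : ℕ) :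
    2 * ∑ j ∈ range (2 ^ n), takagi n j + 2 ^ n = 2 ^ n * 2 ^ n := by
  induction n with
  | zero => simp [takagi]
  | succ n ih =>
    have h₀ : takagi n (2 ^ n) = 0 := by
      rw [← takagi_symm le_rfl, Nat.sub_self, takagi_zero_right]
    have h : takagiWindow n (2 ^ n) = 2 * ∑ j ∈ range (2 ^ n), takagi n j := by
      rw [takagiWindow, h₀, add_zero]
    rw [sum_takagi_eq_window, takagiWindow_succ_left le_rfl, h, pow_succ 2 n]
    nlinarith

lemma two_mul_takagiWindow_half (n : ℕ) :
    2 * takagiWindow (n + 1) (2 ^ n) + 2 ^ (n + 1) = 2 ^ (n + 1) * 2 ^ (n + 1) := by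
  rw [← sum_takagi_eq_window, sum_takagi]

lemma takagiWindow_le (n i : ℕ) (h : 2 * i ≤ 2 ^ n) : takagiWindow n i ≤ i * 2 ^ n := by
  induction n with
  | zero =>
    obtain rfl : i = 0 := by simp at h; omega
    simp [takagiWindow_zero_right]
  | succ n ih =>
    by_cases hi : 2 * i ≤ 2 ^ n
    · rw [takagiWindow_succ_left (by omega)]
      have := ih hi
      rw [pow_succ 2 n]
      nlinarith
    · cases n with
      | zero =>
        obtain rfl : i = 1 := by simp at h hi; omega
        simp [takagiWindow, takagi]
      | succ n =>
        have e₁ : 2 ^ (n + 1) = 2 * 2 ^ n := by ring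
        have e₂ : 2 ^ (n + 2) = 4 * 2 ^ n := by ring
        have step : ∀ d i, i + d = 2 ^ (n + 1) → 2 ^ n ≤ i →
            takagiWindow (n + 2) i + d * 2 ^ (n + 2) ≤ takagiWindow (n + 2) (2 ^ (n + 1)) := by
          intro d
          induction d with
          | zero => intro i hi _; rw [← hi]; simp
          | succ d ihd =>
            intro i hi h
            have h₁ := ihd (i + 1) (by omega) (by omega)
            rw [takagiWindow_succ_right] at h₁
            have h₂ := two_pow_le_takagi (n := n) (i := i) h (by omega)
            have h₃ := two_pow_le_takagi (n := n) (i := i + 1) (by omega) (by omega)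
            rw [add_mul]
            omega
        have h₁ := step (2 ^ (n + 1) - i) i (by omega) (by omega)
        have h₂ := two_mul_takagiWindow_half (n + 1)
        obtain ⟨d, hd⟩ : ∃ d, i + d = 2 ^ (n + 1) := ⟨2 ^ (n + 1) - i, by omega⟩
        rw [← hd, Nat.add_sub_cancel_left] at h₁
        have e₃ : 2 ^ (n + 1 + 1) = 2 * (i + d) := by omega
        rw [← hd, e₃] at h₂
        rw [hd] at h₂
        rw [hd] at h₁
        rw [show n + 2 = n + 1 + 1 from rfl, e₃] at h₁
        rw [e₃]
        nlinarith

lemma takagiWindow_le_takagi (n i₀ i : ℕ) (h : i₀ ≤ i) (hi : 4 * i < 2 ^ n) :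
    takagiWindow n i₀ ≤ 2 * i₀ * takagi n i := by
  induction n with
  | zero =>
    obtain rfl : i₀ = 0 := by simp at hi; omega
    simp [takagiWindow_zero_right]
  | succ n ih =>
    have e₁ : 2 ^ (n + 1) = 2 * 2 ^ n := by ring
    rw [takagiWindow_succ_left (by omega), takagi_succ_of_le (by omega)]
    by_cases hi' : 4 * i < 2 ^ n
    · have := ih hi'
      nlinarith
    · have h₁ := takagiWindow_le n i₀ (by omega)
      have h₂ : 2 ^ n ≤ 2 * takagi n i := by
        match n with
        | 0 => simp at hi hi'; omega
        | 1 => simp at hi hi'; omega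
        | n + 2 =>
          have e₂ : 2 ^ (n + 2) = 4 * 2 ^ n := by ring
          have e₃ : 2 ^ (n + 1) = 2 * 2 ^ n := by ring
          have := two_pow_le_takagi (n := n) (i := i) (by omega) (by omega)
          omega
      nlinarith

lemma sum_Ioc_le_sum_path {G : ℕ → ℤ} (hG : ∀ i, 0 ≤ G i) {x : ℕ → ℕ} {a c : ℕ} (hac : a ≤ c)
    (hx : ∀ t, a ≤ t → t < c → x (t + 1) ≤ x t + 1) :
    ∑ i ∈ Ioc (x a) (x c), G i ≤ ∑ t ∈ Ioc a c, G (x t) := by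
  induction c, hac using Nat.le_induction with
  | base => simp
  | succ c hac ih =>
    have ih := ih fun t h₁ h₂ => hx t h₁ (by omega)
    rw [sum_Ioc_succ_top hac]
    have hs : ∑ i ∈ Ioc (x a) (x (c + 1)), G i ≤
        ∑ i ∈ insert (x (c + 1)) (Ioc (x a) (x c)), G i := by
      refine sum_le_sum_of_subset_of_nonneg (fun i hi => ?_) fun i _ _ => hG i
      have := hx c hac (by omega)
      simp only [mem_insert, mem_Ioc] at hi ⊢
      omega
    have hi : ∑ i ∈ insert (x (c + 1)) (Ioc (x a) (x c)), G i ≤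
        G (x (c + 1)) + ∑ i ∈ Ioc (x a) (x c), G i := by
      by_cases h : x (c + 1) ∈ Ioc (x a) (x c)
      · rw [insert_eq_of_mem h]
        linarith [hG (x (c + 1))]
      · rw [sum_insert h]
    linarith

lemma sum_Ico_le_sum_path {G : ℕ → ℤ} (hG : ∀ i, 0 ≤ G i) {x : ℕ → ℕ} {a c : ℕ} (hac : a ≤ c)
    (hx : ∀ t, a ≤ t → t < c → x t ≤ x (t + 1) + 1) :
    ∑ i ∈ Ico (x c) (x a), G i ≤ ∑ t ∈ Ioc a c, G (x t) := by
  induction c, hac using Nat.le_induction with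
  | base => simp
  | succ c hac ih =>
    have ih := ih fun t h₁ h₂ => hx t h₁ (by omega)
    rw [sum_Ioc_succ_top hac]
    have hs : ∑ i ∈ Ico (x (c + 1)) (x a), G i ≤
        ∑ i ∈ insert (x (c + 1)) (Ico (x c) (x a)), G i := by
      refine sum_le_sum_of_subset_of_nonneg (fun i hi => ?_) fun i _ _ => hG i
      have := hx c hac (by omega)
      simp only [mem_insert, mem_Ico] at hi ⊢
      omega
    have hi : ∑ i ∈ insert (x (c + 1)) (Ico (x c) (x a)), G i ≤
        G (x (c + 1)) + ∑ i ∈ Ico (x c) (x a), G i := by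
      by_cases h : x (c + 1) ∈ Ico (x c) (x a)
      · rw [insert_eq_of_mem h]
        linarith [hG (x (c + 1))]
      · rw [sum_insert h]
    linarith

lemma sum_Ico_add_sum_Ioc_takagi (n : ℕ) {i k : ℕ} (h : i ≤ k) :
    ∑ j ∈ Ico i k, (takagi n j : ℤ) + ∑ j ∈ Ioc i k, (takagi n j : ℤ) =
      takagiWindow n k - takagiWindow n i := by
  induction k, h using Nat.le_induction with
  | base => simp
  | succ k hk ih =>
    rw [sum_Ico_succ_top hk, sum_Ioc_succ_top hk, takagiWindow_succ_right]
    push_cast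
    linarith

/-- Along a path of unit steps which dips below `2 ^ n` for a time of at most `2 ^ (n + 1)`,
the average of `takagi (n + 1)` is at least its average over a period. -/
lemma sum_dip_nonneg (n : ℕ) {x : ℕ → ℕ} {a c : ℕ} (hac : a ≤ c) (hlen : c ≤ a + 2 ^ (n + 1))
    (ha : x a = 2 ^ n) (hc : x c = 2 ^ n) (hle : ∀ t, a ≤ t → t ≤ c → x t ≤ 2 ^ n)
    (hup : ∀ t, a ≤ t → t < c → x (t + 1) ≤ x t + 1)
    (hdown : ∀ t, a ≤ t → t < c → x t ≤ x (t + 1) + 1) :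
    0 ≤ ∑ t ∈ Ioc a c, (2 * (takagi (n + 1) (x t) : ℤ) - (2 ^ (n + 1) - 1)) := by
  obtain ⟨p, hp, hpmin⟩ := exists_min_image (Icc a c) x ⟨a, by simp [hac]⟩
  rw [mem_Icc] at hp
  have hx₀ : x p ≤ 2 ^ n := hle p hp.1 hp.2
  obtain ⟨i, hi, himin⟩ := exists_min_image (Icc (x p) (2 ^ n)) (takagi (n + 1))
    ⟨x p, by simp [hx₀]⟩
  rw [mem_Icc] at hi
  have hrange : ∀ t ∈ Ioc a c, x t ∈ Icc (x p) (2 ^ n) := by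
    intro t ht
    rw [mem_Ioc] at ht
    exact mem_Icc.2 ⟨hpmin t (mem_Icc.2 ⟨ht.1.le, ht.2⟩), hle t ht.1.le ht.2⟩
  set A : ℤ := 2 * (takagi (n + 1) i : ℤ) - (2 ^ (n + 1) - 1) with hA
  by_cases hA0 : 0 ≤ A
  · refine sum_nonneg fun t ht => ?_
    have := himin _ (hrange t ht)
    zify at this
    linarith
  have e₁ : 2 ^ (n + 1) = 2 * 2 ^ n := by ring
  have e₁' : (2 : ℤ) ^ (n + 1) = 2 * 2 ^ n := by ring
  have hi4 : 4 * i < 2 ^ (n + 1) := by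
    have ht : takagi (n + 1) i < 2 ^ n := by
      zify
      linarith
    by_contra hcon
    cases n with
    | zero =>
      obtain rfl : i = 1 := by simp at hi hcon; omega
      simp [takagi] at ht
    | succ n =>
      have e₂ : 2 ^ (n + 1) = 2 * 2 ^ n := by ring
      have := two_pow_le_takagi (n := n) (i := i) (by omega) (by omega)
      rw [show n + 1 + 1 = n + 2 from rfl] at ht
      omega
  have hwin := takagiWindow_le_takagi (n + 1) (x p) i hi.1 hi4
  have hfull := two_mul_takagiWindow_half n
  set G : ℕ → ℤ := fun j => if j ∈ Icc (x p) (2 ^ n) then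
    2 * (takagi (n + 1) j : ℤ) - (2 ^ (n + 1) - 1) - A else 0 with hG
  have hG0 : ∀ j, 0 ≤ G j := by
    intro j
    simp only [hG]
    split_ifs with h
    · have := himin _ h
      zify at this
      linarith
    · exact le_rfl
  have hl := sum_Ico_le_sum_path hG0 hp.1 fun t h₁ h₂ => hdown t h₁ (by omega)
  have hr := sum_Ioc_le_sum_path hG0 hp.2 fun t h₁ h₂ => hup t (by omega) h₂
  rw [ha] at hl
  rw [hc] at hr
  have hsplit : ∑ t ∈ Ioc a c, (2 * (takagi (n + 1) (x t) : ℤ) - (2 ^ (n + 1) - 1)) =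
      ∑ t ∈ Ioc a p, G (x t) + ∑ t ∈ Ioc p c, G (x t) + (c - a) * A := by
    rw [sum_Ioc_consecutive _ hp.1 hp.2]
    have : ∀ t ∈ Ioc a c, 2 * (takagi (n + 1) (x t) : ℤ) - (2 ^ (n + 1) - 1) = G (x t) + A := by
      intro t ht
      simp only [hG, if_pos (hrange t ht)]
      ring
    rw [sum_congr rfl this, sum_add_distrib]
    simp [Nat.cast_sub hac]
  have hlevel : ∑ j ∈ Ico (x p) (2 ^ n), G j + ∑ j ∈ Ioc (x p) (2 ^ n), G j =
      2 * (takagiWindow (n + 1) (2 ^ n) - takagiWindow (n + 1) (x p) : ℤ)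
        - 2 * (2 ^ n - x p) * (2 ^ (n + 1) - 1 + A) := by
    rw [← sum_Ico_add_sum_Ioc_takagi (n + 1) hx₀]
    have h₁ : ∑ j ∈ Ico (x p) (2 ^ n), G j =
        ∑ j ∈ Ico (x p) (2 ^ n), (2 * (takagi (n + 1) j : ℤ) - (2 ^ (n + 1) - 1 + A)) := by
      refine sum_congr rfl fun j hj => ?_
      rw [mem_Ico] at hj
      simp only [hG, if_pos (mem_Icc.2 ⟨hj.1, hj.2.le⟩)]
      ring
    have h₂ : ∑ j ∈ Ioc (x p) (2 ^ n), G j =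
        ∑ j ∈ Ioc (x p) (2 ^ n), (2 * (takagi (n + 1) j : ℤ) - (2 ^ (n + 1) - 1 + A)) := by
      refine sum_congr rfl fun j hj => ?_
      rw [mem_Ioc] at hj
      simp only [hG, if_pos (mem_Icc.2 ⟨hj.1.le, hj.2⟩)]
      ring
    rw [h₁, h₂]
    simp only [sum_sub_distrib, ← mul_sum, sum_const, Nat.card_Ico, Nat.card_Ioc, nsmul_eq_mul,
      Nat.cast_sub hx₀]
    push_cast
    ring
  zify at hwin hfull hlen
  rw [e₁'] at *
  rw [hsplit]
  nlinarith

/-- Discrete averaging over a half-turn of a cycle of length `4 * 2 ^ (n + 1)`. -/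
lemma cyclic_sum_nonneg {ι : Type*} (n M : ℕ) (hM : M = 2 ^ (n + 1)) (x : ι → ℕ → ℕ) (q : ℕ → ℤ)
    (hup : ∀ i t, t + 1 < 4 * M → x i (t + 1) ≤ x i t + 1)
    (hdown : ∀ i t, t + 1 < 4 * M → x i t ≤ x i (t + 1) + 1)
    (hanti : ∀ i t, t < 2 * M → x i (t + 2 * M) + x i t = 2 * M)
    (hcompl : ∀ i, ∃ j, ∀ t, t < 4 * M → x i t + x j t = 2 * M)
    (hdisj : ∀ i j t, t < 4 * M → i ≠ j → M ≤ x i t + x j t)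
    (hdiam : ∀ i s t, s ≤ t → t ≤ s + 2 * M → t < 4 * M → t - s ≤ x i s + x i t)
    (hq : ∀ i t, t < 4 * M → x i t ≤ 2 ^ n → 4 * (takagi (n + 1) (x i t) : ℤ) ≤ q t)
    (hq' : ∀ t, t < 4 * M → (∀ i, 2 ^ n ≤ x i t) → 2 * (M : ℤ) ≤ q t)
    (hper : ∀ t, t < 2 * M → q (t + 2 * M) = q t) :
    0 ≤ ∑ t ∈ range (2 * M), (q t - 2 * (M - 1)) := by
  have hM2 : M = 2 * 2 ^ n := by rw [hM]; ring
  have hpos : 0 < 2 ^ n := by positivity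
  have other : ∀ i t, t < 4 * M → x i t = 2 ^ n → ∀ j, 2 ^ n ≤ x j t := by
    intro i t ht hi j
    by_cases hij : i = j
    · subst hij; exact hi.ge
    · have := hdisj i j t ht hij
      omega
  have first : ∀ i a b, a < b → b < 4 * M → x i a < 2 ^ n → 2 ^ n ≤ x i b →
      ∃ c, a < c ∧ c ≤ b ∧ x i c = 2 ^ n ∧ ∀ t, a ≤ t → t < c → x i t < 2 ^ n := by
    intro i a b hab hb ha hxb
    have hex : ∃ c, a < c ∧ 2 ^ n ≤ x i c := ⟨b, hab, hxb⟩
    classical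
    obtain ⟨h₁, h₂⟩ := Nat.find_spec hex
    have hmin : ∀ t, a ≤ t → t < Nat.find hex → x i t < 2 ^ n := by
      intro t ht₁ ht₂
      rcases ht₁.eq_or_lt with rfl | ht₁
      · exact ha
      · have := Nat.find_min hex ht₂
        push Not at this
        exact this ht₁
    have hle : Nat.find hex ≤ b := Nat.find_le ⟨hab, hxb⟩
    refine ⟨Nat.find hex, h₁, hle, ?_, hmin⟩
    have h₃ := hmin (Nat.find hex - 1) (by omega) (by omega)
    have h₄ := hup i (Nat.find hex - 1) (by omega)
    rw [Nat.sub_add_cancel (by omega)] at h₄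
    omega
  have main : ∀ d a b, b = a + d → d ≤ 2 * M → b < 4 * M → (∀ i, 2 ^ n ≤ x i a) →
      (∀ i, 2 ^ n ≤ x i b) → 0 ≤ ∑ t ∈ Ioc a b, (q t - 2 * (M - 1)) := by
    intro d
    induction d using Nat.strong_induction_on with
    | _ d ih =>
    intro a b hb hd hb4 hxa hxb
    rcases Nat.eq_zero_or_pos d with rfl | hd0
    · simp [hb]
    by_cases hgood : ∀ i, 2 ^ n ≤ x i (a + 1)
    · have h₁ := ih (d - 1) (by omega) (a + 1) b (by omega) (by omega) hb4 hgood hxb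
      rw [← sum_Ioc_consecutive _ (Nat.le_succ a) (show a + 1 ≤ b by omega), Nat.Ioc_succ_singleton,
        sum_singleton]
      have := hq' (a + 1) (by omega) hgood
      linarith
    · push Not at hgood
      obtain ⟨i, hi⟩ := hgood
      have hne : a + 1 ≠ b := by
        rintro h
        rw [h] at hi
        exact absurd (hxb i) (by omega)
      have hai : x i a = 2 ^ n := by
        have := hdown i a (by omega)
        have := hxa i
        omega
      obtain ⟨c, hc₁, hc₂, hc₃, hc₄⟩ := first i (a + 1) b (by omega) hb4 hi (hxb i)
      have hdi := hdiam i a c (by omega) (by omega) (by omega)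
      rw [hai, hc₃] at hdi
      have hle : ∀ t, a ≤ t → t ≤ c → x i t ≤ 2 ^ n := by
        intro t h₁ h₂
        rcases h₁.eq_or_lt with rfl | h₁
        · exact hai.le
        rcases h₂.eq_or_lt with rfl | h₂
        · exact hc₃.le
        exact (hc₄ t h₁ h₂).le
      have hdip := sum_dip_nonneg n (x := x i) (a := a) (c := c) (by omega) (by omega) hai hc₃ hle
        (fun t h₁ h₂ => hup i t (by omega)) (fun t h₁ h₂ => hdown i t (by omega))
      have hrest := ih (b - c) (by omega) c b (by omega) (by omega) hb4
        (other i c (by omega) hc₃) hxb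
      rw [← sum_Ioc_consecutive _ (show a ≤ c by omega) hc₂]
      have hcmp : 2 * ∑ t ∈ Ioc a c, (2 * (takagi (n + 1) (x i t) : ℤ) - (2 ^ (n + 1) - 1)) ≤
          ∑ t ∈ Ioc a c, (q t - 2 * (M - 1)) := by
        rw [mul_sum]
        refine sum_le_sum fun t ht => ?_
        rw [mem_Ioc] at ht
        have := hq i t (by omega) (hle t (by omega) (by omega))
        rw [hM]
        push_cast
        linarith
      linarith
  obtain ⟨a, ha, hga⟩ : ∃ a, a < 2 * M ∧ ∀ i, 2 ^ n ≤ x i a := by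
    by_cases h0 : ∀ i, 2 ^ n ≤ x i 0
    · exact ⟨0, by omega, h0⟩
    push Not at h0
    obtain ⟨i, hi⟩ := h0
    have h2 := hanti i 0 (by omega)
    rw [zero_add] at h2
    obtain ⟨c, -, hc₂, hc₃, -⟩ := first i 0 (2 * M) (by omega) (by omega) hi (by omega)
    have : c ≠ 2 * M := by rintro rfl; omega
    exact ⟨c, by omega, other i c (by omega) hc₃⟩
  have hgb : ∀ i, 2 ^ n ≤ x i (a + 2 * M) := by
    intro i
    obtain ⟨j, hj⟩ := hcompl i
    have h₁ := hj a (by omega)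
    have h₂ := hanti i a ha
    have h₃ := hga j
    omega
  have hfin := main (2 * M) a (a + 2 * M) rfl le_rfl (by omega) hga hgb
  have hshift : ∑ t ∈ Ico (2 * M) (a + 2 * M + 1), (q t - 2 * (M - 1)) =
      ∑ t ∈ Ico 0 (a + 1), (q t - 2 * (M - 1)) := by
    have h := sum_Ico_add' (fun t => q t - 2 * ((M : ℤ) - 1)) 0 (a + 1) (2 * M)
    rw [zero_add, show a + 1 + 2 * M = a + 2 * M + 1 by ring] at h
    rw [← h]
    refine sum_congr rfl fun t ht => ?_
    rw [mem_Ico] at ht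
    rw [hper t (by omega)]
  have hIoc : Ioc a (a + 2 * M) = Ico (a + 1) (a + 2 * M + 1) := by
    ext t
    simp only [mem_Ioc, mem_Ico]
    omega
  rw [hIoc, ← sum_Ico_consecutive _ (show a + 1 ≤ 2 * M by omega) (by omega), hshift, add_comm,
    sum_Ico_consecutive _ (by omega) (by omega)] at hfin
  rwa [range_eq_Ico]

/-- The vertex of the cube obtained from `u` by changing its `j`-th coordinate. -/
def flipAt {n : ℕ} (j : Fin n) (u : Fin n → Bool) : Fin n → Bool := Function.update u j (!u j)

lemma flipAt_same {n : ℕ} (j : Fin n) (u : Fin n → Bool) : flipAt j u j = !u j := by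
  simp [flipAt]

lemma flipAt_of_ne {n : ℕ} {i j : Fin n} (h : i ≠ j) (u : Fin n → Bool) :
    flipAt j u i = u i := by
  simp [flipAt, h]

/-- The sum of `F` over all ordered pairs of adjacent vertices of the cube. -/
def edgeSum {n : ℕ} {A : Type*} [AddCommMonoid A] (F : (Fin n → Bool) → (Fin n → Bool) → A) : A :=
  ∑ u, ∑ j, F u (flipAt j u)

lemma cubeAdj_iff {n : ℕ} {u v : Fin n → Bool} : cubeAdj u v ↔ ∃ j, flipAt j u = v := by
  rw [cubeAdj, diffCount, card_eq_one]
  constructor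
  · rintro ⟨j, hj⟩
    refine ⟨j, funext fun i => ?_⟩
    have hi := Finset.ext_iff.1 hj i
    simp only [mem_filter, mem_univ, true_and, mem_singleton] at hi
    by_cases h : i = j
    · subst h
      rw [flipAt_same]
      have := hi.2 rfl
      revert this
      cases u i <;> cases v i <;> simp
    · rw [flipAt_of_ne h]
      by_contra hne
      exact h (hi.1 hne)
  · rintro ⟨j, rfl⟩
    refine ⟨j, Finset.ext fun i => ?_⟩
    simp only [mem_filter, mem_univ, true_and, mem_singleton]
    by_cases h : i = j
    · subst h
      simp [flipAt_same]
    · simp [flipAt_of_ne h, h]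

lemma flipAt_injective {n : ℕ} (u : Fin n → Bool) : Function.Injective fun j => flipAt j u := by
  intro i j h
  by_contra hne
  have := congrFun h i
  simp [flipAt_same, flipAt_of_ne hne] at this

lemma sum_cubeAdj {n : ℕ} {A : Type*} [AddCommMonoid A]
    (F : (Fin n → Bool) → (Fin n → Bool) → A) :
    ∑ u, ∑ v, (if cubeAdj u v then F u v else 0) = edgeSum F := by
  refine sum_congr rfl fun u _ => ?_
  rw [← sum_filter]
  have : univ.filter (fun v => cubeAdj u v) = univ.image fun j => flipAt j u := by
    ext v
    simp [cubeAdj_iff]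
  rw [this, sum_image fun i _ j _ h => flipAt_injective u h]

/-- Insertion of a coordinate in a vertex of the cube. -/
abbrev insertBit {n : ℕ} (j : Fin (n + 1)) (b : Bool) (w : Fin n → Bool) : Fin (n + 1) → Bool :=
  Fin.insertNth (α := fun _ => Bool) j b w

lemma flipAt_insertBit_same {n : ℕ} (j : Fin (n + 1)) (b : Bool) (w : Fin n → Bool) :
    flipAt j (insertBit j b w) = insertBit j (!b) w := by
  funext i
  rcases Fin.eq_self_or_eq_succAbove j i with rfl | ⟨k, rfl⟩
  · simp [flipAt_same, insertBit]
  · simp [flipAt_of_ne (Fin.succAbove_ne j k), insertBit]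

lemma flipAt_insertBit_succAbove {n : ℕ} (j : Fin (n + 1)) (k : Fin n) (b : Bool)
    (w : Fin n → Bool) :
    flipAt (j.succAbove k) (insertBit j b w) = insertBit j b (flipAt k w) := by
  funext i
  rcases Fin.eq_self_or_eq_succAbove j i with rfl | ⟨l, rfl⟩
  · simp [flipAt_of_ne (Fin.succAbove_ne i k).symm, insertBit]
  · by_cases h : l = k
    · subst h
      simp [flipAt_same, insertBit]
    · have : j.succAbove l ≠ j.succAbove k := fun h' => h (Fin.succAbove_right_injective h')
      simp [flipAt_of_ne h, flipAt_of_ne this, insertBit]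

lemma sum_insertBit {n : ℕ} {A : Type*} [AddCommMonoid A] (j : Fin (n + 1))
    (f : (Fin (n + 1) → Bool) → A) :
    ∑ v, f v = ∑ w, f (insertBit j false w) + ∑ w, f (insertBit j true w) := by
  rw [← (Fin.insertNthEquiv (fun _ => Bool) j).sum_comp, Fintype.sum_prod_type,
    Fintype.sum_bool, add_comm]
  rfl

lemma edgeSum_insertBit {n : ℕ} {A : Type*} [AddCommMonoid A] (j : Fin (n + 1))
    (F : (Fin (n + 1) → Bool) → (Fin (n + 1) → Bool) → A) :
    edgeSum F = edgeSum (fun w w' => F (insertBit j false w) (insertBit j false w')) +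
      edgeSum (fun w w' => F (insertBit j true w) (insertBit j true w')) +
      ∑ w, (F (insertBit j false w) (insertBit j true w) +
        F (insertBit j true w) (insertBit j false w)) := by
  rw [edgeSum, sum_insertBit j]
  simp only [Fin.sum_univ_succAbove _ j, flipAt_insertBit_same, flipAt_insertBit_succAbove,
    sum_add_distrib, Bool.not_false, Bool.not_true, edgeSum]
  abel

lemma edgeSum_add {n : ℕ} {A : Type*} [AddCommMonoid A]
    (F G : (Fin n → Bool) → (Fin n → Bool) → A) :
    edgeSum (fun u v => F u v + G u v) = edgeSum F + edgeSum G := by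
  simp [edgeSum, sum_add_distrib]

lemma edgeSum_mul_left {n : ℕ} (c : ℤ) (F : (Fin n → Bool) → (Fin n → Bool) → ℤ) :
    edgeSum (fun u v => c * F u v) = c * edgeSum F := by
  simp [edgeSum, mul_sum]

lemma edgeSum_le_edgeSum {n : ℕ} {F G : (Fin n → Bool) → (Fin n → Bool) → ℤ}
    (h : ∀ u v, F u v ≤ G u v) : edgeSum F ≤ edgeSum G :=
  sum_le_sum fun _ _ => sum_le_sum fun _ _ => h _ _

lemma edgeSum_nonneg {n : ℕ} {F : (Fin n → Bool) → (Fin n → Bool) → ℤ}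
    (h : ∀ u v, 0 ≤ F u v) : 0 ≤ edgeSum F :=
  sum_nonneg fun _ _ => sum_nonneg fun _ _ => h _ _

lemma edgeSum_sum {n : ℕ} {ι A : Type*} [AddCommMonoid A] (s : Finset ι)
    (F : ι → (Fin n → Bool) → (Fin n → Bool) → A) :
    edgeSum (fun u v => ∑ i ∈ s, F i u v) = ∑ i ∈ s, edgeSum (F i) := by
  simp only [edgeSum]
  rw [sum_comm (s := s)]
  refine sum_congr rfl fun u _ => ?_
  rw [sum_comm]

/-- The number of ordered pairs of adjacent vertices separated by `p`. -/
def cutSize {n : ℕ} (p : (Fin n → Bool) → Bool) : ℤ :=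
  edgeSum fun u v => if p u ≠ p v then 1 else 0

/-- The number of vertices satisfying `p`. -/
def volume {n : ℕ} (p : (Fin n → Bool) → Bool) : ℕ := #{v | p v = true}

lemma volume_le {n : ℕ} (p : (Fin n → Bool) → Bool) : volume p ≤ 2 ^ n := by
  refine (card_le_univ _).trans ?_
  simp

lemma volume_insertBit {n : ℕ} (j : Fin (n + 1)) (p : (Fin (n + 1) → Bool) → Bool) :
    volume p = volume (fun w => p (insertBit j false w)) +
      volume (fun w => p (insertBit j true w)) := by
  simp only [volume, card_filter]
  exact sum_insertBit j fun v => if p v = true then 1 else 0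

/-- The number of edges in direction `j` separated by `p`. -/
def dirCutSize {n : ℕ} (j : Fin (n + 1)) (p : (Fin (n + 1) → Bool) → Bool) : ℤ :=
  ∑ w, if p (insertBit j false w) ≠ p (insertBit j true w) then 1 else 0

lemma cutSize_insertBit {n : ℕ} (j : Fin (n + 1)) (p : (Fin (n + 1) → Bool) → Bool) :
    cutSize p = cutSize (fun w => p (insertBit j false w)) +
      cutSize (fun w => p (insertBit j true w)) + 2 * dirCutSize j p := by
  rw [cutSize, edgeSum_insertBit j]
  congr 1
  rw [dirCutSize, mul_sum]
  refine sum_congr rfl fun w _ => ?_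
  cases p (insertBit j false w) <;> cases p (insertBit j true w) <;> simp

lemma abs_volume_sub_le {n : ℕ} (j : Fin (n + 1)) (p : (Fin (n + 1) → Bool) → Bool) :
    |(volume (fun w => p (insertBit j false w)) : ℤ) - volume (fun w => p (insertBit j true w))|
      ≤ dirCutSize j p := by
  simp only [volume, card_filter, dirCutSize]
  push_cast
  rw [← sum_sub_distrib]
  refine (abs_sum_le_sum_abs _ _).trans (sum_le_sum fun w _ => ?_)
  cases p (insertBit j false w) <;> cases p (insertBit j true w) <;> simp

/-- The edge-isoperimetric inequality of the cube. -/
lemma takagi_le_cutSize {n : ℕ} (p : (Fin n → Bool) → Bool) :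
    2 * (takagi n (volume p) : ℤ) ≤ cutSize p := by
  induction n with
  | zero => simp [takagi, cutSize, edgeSum]
  | succ n ih =>
    rw [cutSize_insertBit 0, volume_insertBit 0]
    have h₁ := ih fun w => p (insertBit 0 false w)
    have h₂ := ih fun w => p (insertBit 0 true w)
    have h₃ := takagi_add_le (volume_le fun w => p (insertBit 0 false w))
      (volume_le fun w => p (insertBit 0 true w))
    have h₄ := abs_volume_sub_le 0 p
    linarith

/-- The unnormalised first-level Fourier coefficient in direction `j`. -/
def fourierOne {n : ℕ} (j : Fin n) (g : (Fin n → Bool) → ℤ) : ℤ :=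
  ∑ v, if v j then g v else -g v

lemma dirichlet_insertBit {n : ℕ} (g : (Fin (n + 1) → Bool) → ℤ) :
    2 * edgeSum (fun u v => (g u - g v) ^ 2) =
      edgeSum (fun u v => ((g (insertBit 0 false u) + g (insertBit 0 true u)) -
        (g (insertBit 0 false v) + g (insertBit 0 true v))) ^ 2) +
      edgeSum (fun u v => ((g (insertBit 0 false u) - g (insertBit 0 true u)) -
        (g (insertBit 0 false v) - g (insertBit 0 true v))) ^ 2) +
      4 * ∑ w, (g (insertBit 0 false w) - g (insertBit 0 true w)) ^ 2 := by
  rw [edgeSum_insertBit 0, ← edgeSum_add, ← edgeSum_add, mul_add, ← edgeSum_mul_left, mul_sum,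
    mul_sum]
  congr 1
  · congr 1
    funext u v
    ring
  · refine sum_congr rfl fun w _ => ?_
    ring

lemma sum_sq_insertBit {n : ℕ} (g : (Fin (n + 1) → Bool) → ℤ) :
    2 * ∑ v, g v ^ 2 = ∑ w, (g (insertBit 0 false w) + g (insertBit 0 true w)) ^ 2 +
      ∑ w, (g (insertBit 0 false w) - g (insertBit 0 true w)) ^ 2 := by
  rw [sum_insertBit 0, ← sum_add_distrib, ← sum_add_distrib, mul_sum]
  refine sum_congr rfl fun w _ => ?_
  ring

/-- The Poincaré inequality on the cube. -/
lemma poincare {n : ℕ} (g : (Fin n → Bool) → ℤ) :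
    4 * 2 ^ n * ∑ v, g v ^ 2 ≤
      2 ^ n * edgeSum (fun u v => (g u - g v) ^ 2) + 4 * (∑ v, g v) ^ 2 := by
  induction n with
  | zero => simp [edgeSum]
  | succ n ih =>
    have h₁ := ih fun w => g (insertBit 0 false w) + g (insertBit 0 true w)
    have h₂ := dirichlet_insertBit g
    have h₃ := sum_sq_insertBit g
    have h₄ : 0 ≤ edgeSum (fun u v => ((g (insertBit 0 false u) - g (insertBit 0 true u)) -
        (g (insertBit 0 false v) - g (insertBit 0 true v))) ^ 2) :=
      edgeSum_nonneg fun _ _ => sq_nonneg _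
    rw [sum_add_distrib, ← sum_insertBit 0] at h₁
    have h₅ : (0 : ℤ) ≤ 2 ^ n := by positivity
    have h₆ := mul_nonneg h₅ h₄
    have h₇ := congrArg (fun z => (2 : ℤ) ^ n * z) h₂
    have h₈ := congrArg (fun z => (2 : ℤ) ^ n * z) h₃
    simp only [mul_add] at h₇ h₈
    rw [pow_succ]
    linarith

/-- The second-level Poincaré inequality on the cube. -/
lemma poincare_two {n : ℕ} (g : (Fin n → Bool) → ℤ) :
    8 * 2 ^ n * ∑ v, g v ^ 2 ≤ 2 ^ n * edgeSum (fun u v => (g u - g v) ^ 2) +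
      4 * ∑ j, fourierOne j g ^ 2 + 8 * (∑ v, g v) ^ 2 := by
  induction n with
  | zero => simp [edgeSum]
  | succ n ih =>
    have h₁ := ih fun w => g (insertBit 0 false w) + g (insertBit 0 true w)
    have h₂ := dirichlet_insertBit g
    have h₃ := sum_sq_insertBit g
    have h₄ := poincare fun w => g (insertBit 0 false w) - g (insertBit 0 true w)
    rw [sum_add_distrib, ← sum_insertBit 0] at h₁
    have h₅ : fourierOne 0 g ^ 2 =
        (∑ w, (g (insertBit 0 false w) - g (insertBit 0 true w))) ^ 2 := by
      rw [fourierOne, sum_insertBit 0, sum_sub_distrib]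
      simp only [insertBit, Fin.insertNth_apply_same, sum_neg_distrib, if_true, Bool.false_eq_true,
        if_false]
      ring
    have h₆ : ∀ k : Fin n, fourierOne k.succ g =
        fourierOne k fun w => g (insertBit 0 false w) + g (insertBit 0 true w) := by
      intro k
      rw [fourierOne, sum_insertBit 0, fourierOne, ← sum_add_distrib]
      refine sum_congr rfl fun w _ => ?_
      simp only [insertBit, Fin.insertNth_zero', Fin.cons_succ]
      split_ifs <;> ring
    have h₇ := congrArg (fun z => (2 : ℤ) ^ n * z) h₂
    have h₈ := congrArg (fun z => (2 : ℤ) ^ n * z) h₃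
    simp only [mul_add] at h₇ h₈
    rw [Fin.sum_univ_succ, h₅, sum_congr rfl fun k _ => congrArg (· ^ 2) (h₆ k), pow_succ]
    linarith

lemma volume_not {n : ℕ} (p : (Fin n → Bool) → Bool) :
    volume (fun v => !p v) + volume p = 2 ^ n := by
  have h := card_filter_add_card_filter_not (s := (univ : Finset (Fin n → Bool)))
    (fun v => p v = true)
  rw [card_univ, Fintype.card_fun, Fintype.card_bool, Fintype.card_fin] at h
  rw [add_comm, ← h]
  simp [volume]

lemma volume_const_true (n : ℕ) : volume (fun _ : Fin n → Bool => true) = 2 ^ n := by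
  simp [volume]

lemma volume_const_false (n : ℕ) : volume (fun _ : Fin n → Bool => false) = 0 := by
  simp [volume]

lemma volume_mono {n : ℕ} {p q : (Fin n → Bool) → Bool} (h : ∀ v, p v = true → q v = true) :
    volume p ≤ volume q :=
  card_le_card fun v hv => by
    simp only [mem_filter, mem_univ, true_and] at hv ⊢
    exact h v hv

lemma volume_or_add_volume_and {n : ℕ} (p q : (Fin n → Bool) → Bool) :
    volume (fun v => p v || q v) + volume (fun v => p v && q v) = volume p + volume q := by
  simp only [volume, Bool.or_eq_true, Bool.and_eq_true, filter_or, filter_and]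
  exact card_union_add_card_inter _ _

lemma volume_le_add {n : ℕ} {p q r : (Fin n → Bool) → Bool}
    (h : ∀ v, p v = true → q v = true ∨ r v = true) : volume p ≤ volume q + volume r := by
  rw [← volume_or_add_volume_and]
  refine le_add_right (volume_mono fun v hv => ?_)
  simpa using h v hv

lemma volume_coord_and {n : ℕ} (j : Fin (n + 1)) (b : Bool) (p : (Fin (n + 1) → Bool) → Bool) :
    volume (fun v => v j == b && p v) = volume fun w => p (insertBit j b w) := by
  rw [volume_insertBit j]
  cases b <;> simp [volume_const_false, insertBit]

lemma volume_coord {n : ℕ} (j : Fin (n + 1)) (b : Bool) :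
    volume (fun v : Fin (n + 1) → Bool => v j == b) = 2 ^ n := by
  have h := volume_coord_and j b fun _ => true
  simpa [volume_const_true] using h

lemma volume_two_coords {n : ℕ} {i j : Fin (n + 2)} (h : i ≠ j) (b c : Bool) :
    volume (fun v : Fin (n + 2) → Bool => v i == b && v j == c) = 2 ^ n := by
  rw [volume_coord_and]
  obtain ⟨k, rfl⟩ := Fin.exists_succAbove_eq h.symm
  simp only [insertBit, Fin.insertNth_apply_succAbove]
  exact volume_coord k c

/-- A balanced set has at least a quarter of the cube in two half-cubes of distinct directions. -/
lemma le_volume_add_volume {n : ℕ} {p : (Fin (n + 2) → Bool) → Bool}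
    (hp : volume p = 2 ^ (n + 1)) {i j : Fin (n + 2)} (hij : i ≠ j) (b c : Bool) :
    2 ^ n ≤ volume (fun w => p (insertBit i b w)) + volume (fun w => p (insertBit j c w)) := by
  have h₄ : volume (fun v => v i == b && p v) = volume fun w => p (insertBit i b w) :=
    volume_coord_and i b p
  have h₅ : volume (fun v => v j == c && p v) = volume fun w => p (insertBit j c w) :=
    volume_coord_and j c p
  have h₁ := volume_two_coords hij (!b) (!c)
  have h₂ := volume_le_add (p := p) (q := fun v => (v i == b && p v) || (v j == c && p v))
    (r := fun v => v i == !b && v j == !c) fun v hv => by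
      simp only [hv, Bool.and_true]
      cases v i <;> cases v j <;> cases b <;> cases c <;> simp
  have h₃ := volume_le_add (p := fun v => (v i == b && p v) || (v j == c && p v))
    (q := fun v => v i == b && p v) (r := fun v => v j == c && p v) fun v hv => by
      simpa using hv
  rw [pow_succ] at hp
  omega

lemma le_volume_add_volume_add_volume {n : ℕ} {p q : (Fin (n + 1) → Bool) → Bool}
    (hp : volume p = 2 ^ n) (hq : volume q = 2 ^ n) (j : Fin (n + 1)) (b : Bool) :
    2 ^ n ≤ volume (fun w => p (insertBit j b w)) + volume (fun w => q (insertBit j b w)) +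
      volume (fun v => p v && q v) := by
  rw [← volume_coord_and j, ← volume_coord_and j]
  have h₁ := volume_le_add (p := p) (q := fun v => v j == b && p v)
    (r := fun v => v j == !b && p v) fun v hv => by
      cases v j <;> cases b <;> simp [hv]
  have h₂ := volume_le_add (p := q) (q := fun v => v j == b && q v)
    (r := fun v => v j == !b && q v) fun v hv => by
      cases v j <;> cases b <;> simp [hv]
  have h₃ := volume_or_add_volume_and (fun v => v j == !b && p v) (fun v => v j == !b && q v)
  have h₄ : volume (fun v => (v j == !b && p v) || (v j == !b && q v)) ≤
      volume (fun v : Fin (n + 1) → Bool => v j == !b) := volume_mono fun v hv => by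
    simp only [Bool.or_eq_true, Bool.and_eq_true] at hv
    tauto
  have h₅ : volume (fun v => (v j == !b && p v) && (v j == !b && q v)) ≤
      volume (fun v => p v && q v) := volume_mono fun v hv => by
    simp only [Bool.and_eq_true] at hv ⊢
    tauto
  rw [volume_coord] at h₄
  omega

lemma cutSize_not {n : ℕ} (p : (Fin n → Bool) → Bool) : cutSize (fun v => !p v) = cutSize p := by
  simp [cutSize]

lemma cutSize_eq_sum_dirCutSize {n : ℕ} (p : (Fin (n + 1) → Bool) → Bool) :
    cutSize p = ∑ j, 2 * dirCutSize j p := by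
  rw [cutSize, edgeSum, sum_comm]
  refine sum_congr rfl fun j _ => ?_
  rw [sum_insertBit j, dirCutSize, two_mul]
  simp only [flipAt_insertBit_same, Bool.not_false, Bool.not_true]
  congr 1
  refine sum_congr rfl fun w _ => ?_
  cases p (insertBit j false w) <;> cases p (insertBit j true w) <;> simp

/-- Edge-isoperimetry for halved cubes, in terms of the smaller part of a balanced set. -/
lemma balanced_le_cutSize {n : ℕ} {p : (Fin (n + 2) → Bool) → Bool} (hp : volume p = 2 ^ (n + 1))
    {j : Fin (n + 2)} {b : Bool} {x : ℕ} (hx : volume (fun w => p (insertBit j b w)) = x)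
    (hxM : x ≤ 2 ^ n) : 4 * 2 ^ n + 4 * (takagi n x : ℤ) ≤ cutSize p := by
  have h₁ := takagi_le_cutSize fun w => p (insertBit j false w)
  have h₂ := takagi_le_cutSize fun w => p (insertBit j true w)
  have h₃ := abs_volume_sub_le j p
  have h₄ := cutSize_insertBit j p
  have h₅ := volume_insertBit j p
  have h₆ : x ≤ 2 ^ (n + 1) := hxM.trans (Nat.pow_le_pow_right (by norm_num) (by omega))
  have h₇ := takagi_symm h₆
  have h₈ := takagi_succ_of_le hxM
  rw [hp] at h₅
  have h₉ : (2 : ℤ) ^ (n + 1) = 2 * 2 ^ n := by ring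
  cases b
  · rw [hx] at h₁ h₃ h₅
    have h : volume (fun w => p (insertBit j true w)) = 2 ^ (n + 1) - x := by omega
    rw [h, h₇] at h₂
    rw [h, Nat.cast_sub h₆] at h₃
    rw [h₈] at h₁ h₂
    push_cast at h₁ h₂ h₃
    rw [abs_le] at h₃
    linarith [h₃.1]
  · rw [hx] at h₂ h₃ h₅
    have h : volume (fun w => p (insertBit j false w)) = 2 ^ (n + 1) - x := by omega
    rw [h, h₇] at h₁
    rw [h, Nat.cast_sub h₆] at h₃
    rw [h₈] at h₁ h₂
    push_cast at h₁ h₂ h₃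
    rw [abs_le] at h₃
    linarith [h₃.2]

lemma sum_sign {n : ℕ} (p : (Fin n → Bool) → Bool) :
    ∑ v, (if p v then (1 : ℤ) else -1) = 2 * volume p - 2 ^ n := by
  have h := volume_not p
  have h' : ∀ v, (if p v then (1 : ℤ) else -1) = (if p v = true then 1 else 0) -
      (if (!p v) = true then 1 else 0) := by
    intro v
    cases p v <;> simp
  simp only [h', sum_sub_distrib]
  have h₁ : (∑ v, if p v = true then (1 : ℤ) else 0) = volume p := by simp [volume]
  have h₂ : (∑ v, if (!p v) = true then (1 : ℤ) else 0) = volume fun v => !p v := by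
    simp [volume]
  rw [h₁, h₂]
  have h₃ : ((volume (fun v => !p v) + volume p : ℕ) : ℤ) = 2 ^ n := by rw [h]; norm_cast
  push_cast at h₃
  linarith

lemma fourierOne_sign {n : ℕ} (p : (Fin (n + 1) → Bool) → Bool) (j : Fin (n + 1)) :
    fourierOne j (fun v => if p v then 1 else -1) =
      2 * volume (fun w => p (insertBit j true w)) -
        2 * volume (fun w => p (insertBit j false w)) := by
  rw [fourierOne, sum_insertBit j]
  simp only [insertBit, Fin.insertNth_apply_same, sum_neg_distrib, if_true, Bool.false_eq_true,
    if_false]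
  rw [sum_sign, sum_sign]
  ring

/-- A balanced set which is nearly balanced in each direction has a large boundary. -/
lemma six_mul_le_cutSize {n M : ℕ} (hM : M = 2 ^ n) {p : (Fin (n + 2) → Bool) → Bool}
    (hp : volume p = 2 ^ (n + 1))
    (h : ∀ j b, 3 * M ≤ 4 * volume (fun w => p (insertBit j b w))) :
    6 * (M : ℤ) ≤ cutSize p := by
  set g : (Fin (n + 2) → Bool) → ℤ := fun v => if p v then 1 else -1 with hg
  have h₁ := poincare_two g
  have h₂ : ∑ v, g v = 0 := by
    rw [hg, sum_sign, hp]
    push_cast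
    ring
  have h₃ : edgeSum (fun u v => (g u - g v) ^ 2) = 4 * cutSize p := by
    rw [cutSize, ← edgeSum_mul_left]
    congr 1
    funext u v
    simp only [hg]
    cases p u <;> cases p v <;> norm_num
  have h₄ : ∑ v, g v ^ 2 = 2 ^ (n + 2) := by
    have : ∀ v, g v ^ 2 = 1 := by
      intro v
      simp only [hg]
      cases p v <;> norm_num
    simp [this]
  have h₅ : ∀ j, fourierOne j g ^ 2 ≤ M * (2 * dirCutSize j p) := by
    intro j
    have e₁ := fourierOne_sign p j
    have e₂ := abs_volume_sub_le j p
    have e₃ := volume_insertBit j p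
    have e₄ := h j true
    have e₅ := h j false
    rw [hp, pow_succ, ← hM] at e₃
    have e₆ : |fourierOne j g| ≤ M := by
      rw [hg, e₁, abs_le]
      constructor <;> omega
    have e₇ : |fourierOne j g| ≤ 2 * dirCutSize j p := by
      rw [hg, e₁, ← mul_sub, abs_mul, abs_two, abs_sub_comm]
      linarith
    calc fourierOne j g ^ 2 = |fourierOne j g| * |fourierOne j g| := by
          rw [← sq, sq_abs]
      _ ≤ M * (2 * dirCutSize j p) := mul_le_mul e₆ e₇ (abs_nonneg _) (by positivity)
  have h₆ : ∑ j, fourierOne j g ^ 2 ≤ M * cutSize p := by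
    rw [cutSize_eq_sum_dirCutSize, mul_sum]
    exact sum_le_sum fun j _ => h₅ j
  have h₇ : (2 : ℤ) ^ (n + 2) = 4 * M := by rw [hM]; push_cast; ring
  rw [h₂, h₃, h₄, h₇] at h₁
  have hpos : (0 : ℤ) < M := by rw [hM]; positivity
  have h₈ : (M : ℤ) * (128 * M) ≤ M * (20 * cutSize p) := by nlinarith
  have := le_of_mul_le_mul_left h₈ hpos
  linarith

/-- Membership of `a` in the half-circle of the cycle on `1, …, 4M` that starts after `t`. -/
def halfArc (M t a : ℕ) : Bool := decide (t < a ∧ a ≤ t + 2 * M ∨ a + 2 * M ≤ t)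

lemma halfArc_add {M t a : ℕ} (ht : t < 2 * M) (h₁ : 1 ≤ a) (h₂ : a ≤ 4 * M) :
    halfArc M (t + 2 * M) a = !halfArc M t a := by
  rw [Bool.eq_not_iff]
  simp only [halfArc, ne_eq, decide_eq_decide]
  omega

lemma card_halfArc_ne {M a b : ℕ} (ha₁ : 1 ≤ a) (ha₂ : a ≤ 4 * M) (hb₁ : 1 ≤ b)
    (hb₂ : b ≤ 4 * M) :
    #{t ∈ range (2 * M) | halfArc M t a ≠ halfArc M t b} = cycDist (4 * M) a b := by
  wlog hab : a ≤ b generalizing a b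
  · have h := this hb₁ hb₂ ha₁ ha₂ (by omega)
    rw [cycDist, Nat.dist_comm, ← cycDist, ← h]
    simp only [ne_comm]
  rw [cycDist, Nat.dist_eq_sub_of_le hab]
  simp only [halfArc, ne_eq, decide_eq_decide]
  by_cases hb : b ≤ 2 * M
  · have : {t ∈ range (2 * M) | ¬(t < a ∧ a ≤ t + 2 * M ∨ a + 2 * M ≤ t ↔
        t < b ∧ b ≤ t + 2 * M ∨ b + 2 * M ≤ t)} = Ico a b := by
      ext t
      simp only [mem_filter, mem_range, mem_Ico]
      omega
    rw [this, Nat.card_Ico]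
    omega
  · by_cases ha : 2 * M < a
    · have : {t ∈ range (2 * M) | ¬(t < a ∧ a ≤ t + 2 * M ∨ a + 2 * M ≤ t ↔
          t < b ∧ b ≤ t + 2 * M ∨ b + 2 * M ≤ t)} = Ico (a - 2 * M) (b - 2 * M) := by
        ext t
        simp only [mem_filter, mem_range, mem_Ico]
        omega
      rw [this, Nat.card_Ico]
      omega
    · have : {t ∈ range (2 * M) | ¬(t < a ∧ a ≤ t + 2 * M ∨ a + 2 * M ≤ t ↔
          t < b ∧ b ≤ t + 2 * M ∨ b + 2 * M ≤ t)} =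
          range (2 * M) \ Ico (min a (b - 2 * M)) (max a (b - 2 * M)) := by
        ext t
        simp only [mem_filter, mem_range, mem_Ico, mem_sdiff]
        omega
      rw [this, card_sdiff_of_subset, Nat.card_Ico, card_range]
      · omega
      · intro t
        simp only [mem_range, mem_Ico]
        omega

lemma card_filter_label {n N : ℕ} (hN : N = 2 ^ n) {h : (Fin n → Bool) → ℕ}
    (hinj : Function.Injective h) (hmem : ∀ v, 1 ≤ h v ∧ h v ≤ N) (P : ℕ → Bool) :
    volume (fun v => P (h v)) = #{a ∈ Icc 1 N | P a = true} := by
  have himage : univ.image h = Icc 1 N := by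
    refine eq_of_subset_of_card_le ?_ ?_
    · intro a ha
      obtain ⟨v, -, rfl⟩ := mem_image.1 ha
      exact mem_Icc.2 (hmem v)
    · rw [card_image_of_injective _ hinj]
      simp [hN]
  rw [← himage, filter_image, card_image_of_injective _ hinj, volume]

lemma card_halfArc {M t : ℕ} (ht : t < 2 * M) :
    #{a ∈ Icc 1 (4 * M) | halfArc M t a = true} = 2 * M := by
  have : {a ∈ Icc 1 (4 * M) | halfArc M t a = true} = Ioc t (t + 2 * M) := by
    ext a
    simp only [halfArc, mem_filter, mem_Icc, mem_Ioc, decide_eq_true_eq]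
    omega
  rw [this, Nat.card_Ioc]
  omega

lemma card_halfArc_and {M s t : ℕ} (hst : s ≤ t) (hts : t ≤ s + 2 * M) (ht : t < 4 * M) :
    #{a ∈ Icc 1 (4 * M) | (halfArc M s a && halfArc M t a) = true} ≤ 2 * M - (t - s) := by
  by_cases hs : s < 2 * M
  · have : {a ∈ Icc 1 (4 * M) | (halfArc M s a && halfArc M t a) = true} ⊆ Ioc t (s + 2 * M) := by
      intro a
      simp only [halfArc, mem_filter, mem_Icc, mem_Ioc, decide_eq_true_eq, Bool.and_eq_true]
      omega
    refine (card_le_card this).trans ?_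
    rw [Nat.card_Ioc]
    omega
  · have : {a ∈ Icc 1 (4 * M) | (halfArc M s a && halfArc M t a) = true} ⊆
        Icc 1 (s - 2 * M) ∪ Ioc t (4 * M) := by
      intro a
      simp only [halfArc, mem_filter, mem_Icc, mem_Ioc, mem_union, decide_eq_true_eq,
        Bool.and_eq_true]
      omega
    refine (card_le_card this).trans ((card_union_le _ _).trans ?_)
    rw [Nat.card_Ioc, Nat.card_Icc]
    omega

lemma volume_label_le_one {n : ℕ} {h : (Fin n → Bool) → ℕ} (hinj : Function.Injective h) (a : ℕ) :
    volume (fun v => h v == a) ≤ 1 := by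
  refine card_le_one.2 fun u hu v hv => hinj ?_
  simp only [mem_filter, mem_univ, true_and, beq_iff_eq] at hu hv
  rw [hu, hv]

lemma edgeSum_cycDist_eq {n M : ℕ} {h : (Fin n → Bool) → ℕ}
    (hmem : ∀ v, 1 ≤ h v ∧ h v ≤ 4 * M) :
    edgeSum (fun u v => (cycDist (4 * M) (h u) (h v) : ℤ)) =
      ∑ t ∈ range (2 * M), cutSize fun v => halfArc M t (h v) := by
  simp only [cutSize]
  rw [← edgeSum_sum]
  congr 1
  funext u v
  rw [← card_halfArc_ne (hmem u).1 (hmem u).2 (hmem v).1 (hmem v).2, card_filter]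
  push_cast
  rfl

/-- The lower bound for the wirelength of bijective embeddings of the cube in the cycle. -/
lemma le_edgeSum_cycDist {n M : ℕ} (hM : M = 2 ^ n) {h : (Fin (n + 2) → Bool) → ℕ}
    (hinj : Function.Injective h) (hmem : ∀ v, 1 ≤ h v ∧ h v ≤ 4 * M) :
    12 * (M : ℤ) ^ 2 - 4 * M ≤ edgeSum fun u v => (cycDist (4 * M) (h u) (h v) : ℤ) := by
  have h4M : 4 * M = 2 ^ (n + 2) := by rw [hM]; ring
  have h2M : 2 * M = 2 ^ (n + 1) := by rw [hM]; ring
  rw [edgeSum_cycDist_eq hmem]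
  set p : ℕ → (Fin (n + 2) → Bool) → Bool := fun t v => halfArc M t (h v) with hp
  have hpadd : ∀ t, t < 2 * M → p (t + 2 * M) = fun v => !p t v := fun t ht =>
    funext fun v => halfArc_add ht (hmem v).1 (hmem v).2
  have hvol' : ∀ t, t < 2 * M → volume (p t) = 2 * M := fun t ht => by
    rw [hp, ← card_halfArc ht, card_filter_label h4M hinj hmem]
  have hvol : ∀ t, t < 4 * M → volume (p t) = 2 * M := by
    intro t ht
    by_cases h' : t < 2 * M
    · exact hvol' t h'
    · obtain ⟨s, rfl⟩ := Nat.exists_eq_add_of_le (not_lt.1 h')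
      have h₁ := volume_not (p s)
      have h₂ := hvol' s (by omega)
      rw [add_comm (2 * M) s, hpadd s (by omega)]
      omega
  rcases n with _ | n
  · have h₁ : ∀ t ∈ range (2 * M), (4 : ℤ) ≤ cutSize (p t) := by
      intro t ht
      have h₁ := takagi_le_cutSize (p t)
      rw [hvol' t (mem_range.1 ht), hM] at h₁
      have h₂ : takagi (0 + 2) (2 * 2 ^ 0) = 2 := by decide
      rw [h₂] at h₁
      exact_mod_cast h₁
    refine le_trans (le_of_eq ?_) (sum_le_sum h₁)
    rw [hM]
    norm_num
  · let x : Fin (n + 3) × Bool → ℕ → ℕ := fun i t => volume fun w => p t (insertBit i.1 i.2 w)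
    have hsum : ∀ j b t, t < 4 * M → x (j, b) t + x (j, !b) t = 2 * M := by
      intro j b t ht
      rw [← hvol t ht, volume_insertBit j]
      cases b
      · rfl
      · exact add_comm _ _
    have hinj' : ∀ i : Fin (n + 3) × Bool, Function.Injective fun w => h (insertBit i.1 i.2 w) :=
      fun i u v huv => by
        simpa [insertBit] using hinj huv
    have hM2 : M = 2 * 2 ^ n := by rw [hM]; ring
    have key := cyclic_sum_nonneg n M hM x (fun t => cutSize (p t) - 4 * M) ?_ ?_ ?_ ?_ ?_ ?_ ?_ ?_
      ?_
    · have : ∀ t : ℕ, cutSize (p t) - 4 * (M : ℤ) - 2 * (M - 1) = cutSize (p t) - (6 * M - 2) :=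
        fun t => by ring
      simp only [this, sum_sub_distrib, sum_const, card_range, nsmul_eq_mul] at key
      push_cast at key
      linarith
    · intro i t ht
      refine (volume_le_add (q := fun w => p t (insertBit i.1 i.2 w))
        (r := fun w => h (insertBit i.1 i.2 w) ==
          if t < 2 * M then t + 2 * M + 1 else t + 1 - 2 * M) fun w hw => ?_).trans
        (Nat.add_le_add_left (volume_label_le_one (hinj' i) _) _)
      have := hmem (insertBit i.1 i.2 w)
      simp only [hp, halfArc, decide_eq_true_eq, beq_iff_eq] at hw ⊢
      split_ifs <;> omega
    · intro i t ht
      refine (volume_le_add (q := fun w => p (t + 1) (insertBit i.1 i.2 w))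
        (r := fun w => h (insertBit i.1 i.2 w) == t + 1) fun w hw => ?_).trans
        (Nat.add_le_add_left (volume_label_le_one (hinj' i) _) _)
      have := hmem (insertBit i.1 i.2 w)
      simp only [hp, halfArc, decide_eq_true_eq, beq_iff_eq] at hw ⊢
      omega
    · intro i t ht
      simp only [x]
      rw [hpadd t ht, h2M]
      exact volume_not _
    · rintro ⟨j, b⟩
      exact ⟨(j, !b), fun t ht => hsum j b t ht⟩
    · rintro ⟨i, b⟩ ⟨j, c⟩ t ht hne
      by_cases hij : i = j
      · subst hij
        have hc : c = !b := by
          cases b <;> cases c <;> simp_all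
        subst hc
        rw [hsum i b t ht]
        omega
      · rw [hM]
        exact le_volume_add_volume (hvol t ht ▸ h2M) hij b c
    · rintro ⟨j, b⟩ s t hst hts ht
      have h₁ := le_volume_add_volume_add_volume (hvol s (by omega) ▸ h2M) (hvol t ht ▸ h2M) j b
      have h₂ := card_halfArc_and hst hts ht
      rw [← card_filter_label h4M hinj hmem] at h₂
      have h₃ : 2 * M ≤ x (j, b) s + x (j, b) t + (2 * M - (t - s)) :=
        (h2M.le.trans h₁).trans (Nat.add_le_add_left h₂ _)
      omega
    · rintro ⟨j, b⟩ t ht hx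
      have := balanced_le_cutSize (n := n + 1) (hvol t ht ▸ h2M) (rfl : _ = x (j, b) t) (by
        rw [pow_succ]; omega)
      rw [hM]
      push_cast
      linarith
    · intro t ht hx
      by_cases h' : ∃ i, 4 * x i t ≤ 3 * M
      · obtain ⟨⟨j, b⟩, hi⟩ := h'
        have h₁ := balanced_le_cutSize (n := n + 1) (hvol t ht ▸ h2M) (rfl : _ = x (j, b) t) (by
          rw [pow_succ]; omega)
        have h₂ : 2 ^ n ≤ takagi (n + 1) (x (j, b) t) := by
          have h₃ := hx (j, b)
          rcases n with _ | n
          · have : x (j, b) t = 1 := by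
              norm_num at hM2 h₃
              omega
            rw [this]
            decide
          · have h₄ : 2 ^ (n + 1) = 2 * 2 ^ n := by ring
            exact two_pow_le_takagi (by omega) (by omega)
        have h₃ : (2 : ℤ) ^ n ≤ takagi (n + 1) (x (j, b) t) := by exact_mod_cast h₂
        rw [hM]
        push_cast
        rw [pow_succ] at h₁ ⊢
        linarith
      · push Not at h'
        have := six_mul_le_cutSize hM (hvol t ht ▸ h2M) fun j b => (h' (j, b)).le
        linarith
    · intro t ht
      rw [hpadd t ht, cutSize_not]

lemma card_le_ne {N a b : ℕ} (ha : a ≤ N) (hb : b ≤ N) :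
    #{t ∈ range N | decide (a ≤ t) ≠ decide (b ≤ t)} = Nat.dist a b := by
  wlog hab : a ≤ b generalizing a b
  · have h := this hb ha (by omega)
    rw [Nat.dist_comm, ← h]
    simp only [ne_comm]
  rw [Nat.dist_eq_sub_of_le hab, ← Nat.card_Ico]
  congr 1
  ext t
  simp only [ne_eq, decide_eq_decide, mem_filter, mem_range, mem_Ico]
  omega

/-- The lower bound for the wirelength of bijective embeddings of the cube in the path. -/
lemma le_edgeSum_dist {n N : ℕ} (hN : N = 2 ^ n) {h : (Fin n → Bool) → ℕ}
    (hinj : Function.Injective h) (hmem : ∀ v, 1 ≤ h v ∧ h v ≤ N) :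
    (N : ℤ) ^ 2 - N ≤ edgeSum fun u v => (Nat.dist (h u) (h v) : ℤ) := by
  have h₁ : edgeSum (fun u v => (Nat.dist (h u) (h v) : ℤ)) =
      ∑ t ∈ range N, cutSize fun v => decide (h v ≤ t) := by
    simp only [cutSize]
    rw [← edgeSum_sum]
    congr 1
    funext u v
    rw [← card_le_ne (hmem u).2 (hmem v).2, card_filter]
    push_cast
    rfl
  have h₂ : ∀ t ∈ range N, 2 * (takagi n t : ℤ) ≤ cutSize fun v => decide (h v ≤ t) := by
    intro t ht
    have h₃ := takagi_le_cutSize fun v => decide (h v ≤ t)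
    rw [card_filter_label hN hinj hmem fun a => decide (a ≤ t)] at h₃
    have h₄ : {a ∈ Icc 1 N | decide (a ≤ t) = true} = Icc 1 t := by
      ext a
      have := mem_range.1 ht
      simp only [mem_filter, mem_Icc, decide_eq_true_eq]
      omega
    rw [h₄, Nat.card_Icc] at h₃
    exact h₃
  have h₃ := sum_le_sum h₂
  have h₄ := sum_takagi n
  rw [← hN] at h₄
  rw [h₁, sq]
  refine le_trans ?_ h₃
  rw [← mul_sum]
  have : ((2 * ∑ j ∈ range N, takagi n j + N : ℕ) : ℤ) = N * N := by rw [h₄]; push_cast; ring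
  push_cast at this
  linarith

/-- The wirelength of the part of the cube in `p`, when arranged on the integers by `q`. -/
def arrangementCost {n : ℕ} (p : (Fin n → Bool) → Bool) (q : (Fin n → Bool) → ℕ) : ℤ :=
  edgeSum fun u v => if p u && p v then |(q u : ℤ) - q v| else 0

/-- The function on the cube with the given restrictions to the two halves. -/
def glue {n : ℕ} (q₀ q₁ : (Fin n → Bool) → ℕ) (v : Fin (n + 1) → Bool) : ℕ :=
  if v 0 then q₁ (Fin.tail v) else q₀ (Fin.tail v)

lemma glue_insertBit {n : ℕ} (q₀ q₁ : (Fin n → Bool) → ℕ) (b : Bool) (w : Fin n → Bool) :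
    glue q₀ q₁ (insertBit 0 b w) = if b then q₁ w else q₀ w := by
  simp [glue, insertBit]

lemma arrangementCost_glue {n : ℕ} (p : (Fin (n + 1) → Bool) → Bool)
    (q₀ q₁ : (Fin n → Bool) → ℕ) :
    arrangementCost p (glue q₀ q₁) = arrangementCost (fun w => p (insertBit 0 false w)) q₀ +
      arrangementCost (fun w => p (insertBit 0 true w)) q₁ +
      2 * ∑ w, if p (insertBit 0 false w) && p (insertBit 0 true w) then
        |(q₀ w : ℤ) - q₁ w| else 0 := by
  rw [arrangementCost, edgeSum_insertBit 0, mul_sum]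
  simp only [glue_insertBit, Bool.false_eq_true, if_true, if_false]
  congr 1
  refine sum_congr rfl fun w _ => ?_
  rw [abs_sub_comm (q₁ w : ℤ), Bool.and_comm (p (insertBit 0 true w))]
  ring

lemma arrangementCost_congr {n : ℕ} {p : (Fin n → Bool) → Bool} {q q' : (Fin n → Bool) → ℕ}
    (h : ∀ u v, p u = true → p v = true → |(q u : ℤ) - q v| = |(q' u : ℤ) - q' v|) :
    arrangementCost p q = arrangementCost p q' := by
  unfold arrangementCost
  congr 1
  funext u v
  by_cases hp : (p u && p v) = true
  · rw [if_pos hp, if_pos hp]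
    rw [Bool.and_eq_true] at hp
    exact h u v hp.1 hp.2
  · rw [if_neg hp, if_neg hp]

/-- Each part of the cube has an arrangement of small wirelength. -/
lemma exists_arrangement {n : ℕ} (p : (Fin n → Bool) → Bool) :
    ∃ q : (Fin n → Bool) → ℕ, (∀ v, p v = true → q v < volume p) ∧
      (∀ u v, p u = true → p v = true → q u = q v → u = v) ∧
      arrangementCost p q ≤ (volume p : ℤ) ^ 2 - volume p := by
  induction n with
  | zero =>
    refine ⟨fun _ => 0, fun v hv => ?_, fun u v _ _ _ => Subsingleton.elim _ _, ?_⟩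
    · exact card_pos.2 ⟨v, mem_filter.2 ⟨mem_univ _, hv⟩⟩
    · have : (volume p : ℤ) ≤ (volume p : ℤ) ^ 2 := by exact_mod_cast Nat.le_self_pow two_ne_zero _
      simpa [arrangementCost, edgeSum] using this
  | succ n ih =>
    set p₀ : (Fin n → Bool) → Bool := fun w => p (insertBit 0 false w) with hp₀
    set p₁ : (Fin n → Bool) → Bool := fun w => p (insertBit 0 true w) with hp₁
    obtain ⟨q₀, hlt₀, hinj₀, hc₀⟩ := ih p₀
    obtain ⟨q₁, hlt₁, hinj₁, hc₁⟩ := ih p₁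
    have hv := volume_insertBit 0 p
    rw [← hp₀, ← hp₁] at hv
    set a := volume p₀
    set b := volume p₁
    have key : ∀ r₀ r₁ : (Fin n → Bool) → ℕ, (∀ w, p₀ w = true → r₀ w < a) →
        (∀ w, p₁ w = true → r₁ w < b) →
        (∀ u v, p₀ u = true → p₀ v = true → r₀ u = r₀ v → u = v) →
        (∀ u v, p₁ u = true → p₁ v = true → r₁ u = r₁ v → u = v) →
        arrangementCost p (glue r₀ fun w => a + r₁ w) ≤ (volume p : ℤ) ^ 2 - volume p →
        ∃ q : (Fin (n + 1) → Bool) → ℕ, (∀ v, p v = true → q v < volume p) ∧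
          (∀ u v, p u = true → p v = true → q u = q v → u = v) ∧
          arrangementCost p q ≤ (volume p : ℤ) ^ 2 - volume p := by
      intro r₀ r₁ h₀ h₁ i₀ i₁ hc
      have hrep : ∀ v : Fin (n + 1) → Bool, ∃ c w, v = insertBit 0 c w := fun v =>
        ⟨v 0, Fin.tail v, by simp [insertBit]⟩
      refine ⟨_, ?_, ?_, hc⟩
      · intro v hpv
        obtain ⟨c, w, rfl⟩ := hrep v
        rw [glue_insertBit, hv]
        cases c
        · have := h₀ w hpv
          simp only [Bool.false_eq_true, if_false]
          omega
        · have := h₁ w hpv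
          simp only [if_true]
          omega
      · intro u v hpu hpv huv
        obtain ⟨c, w, rfl⟩ := hrep u
        obtain ⟨c', w', rfl⟩ := hrep v
        rw [glue_insertBit, glue_insertBit] at huv
        cases c <;> cases c' <;> simp only [Bool.false_eq_true, if_false, if_true] at huv
        · rw [i₀ w w' hpu hpv huv]
        · have := h₀ w hpu
          omega
        · have := h₀ w' hpv
          omega
        · rw [i₁ w w' hpu hpv (by omega)]
    have hreflect : ∀ (N x y : ℕ), x < N → y < N →
        |((N - 1 - x : ℕ) : ℤ) - ((N - 1 - y : ℕ) : ℤ)| = |(x : ℤ) - y| := by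
      intro N x y hx hy
      rw [abs_sub_comm (x : ℤ)]
      congr 1
      omega
    have e₁ := arrangementCost_glue p q₀ fun w => a + q₁ w
    have e₂ := arrangementCost_glue p (fun w => a - 1 - q₀ w) fun w => a + (b - 1 - q₁ w)
    rw [← hp₀, ← hp₁] at e₁ e₂
    have f₁ : arrangementCost p₁ (fun w => a + q₁ w) = arrangementCost p₁ q₁ :=
      arrangementCost_congr fun u v _ _ => by
        push_cast
        ring_nf
    have f₂ : arrangementCost p₁ (fun w => a + (b - 1 - q₁ w)) = arrangementCost p₁ q₁ :=
      arrangementCost_congr fun u v hu hv => by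
        rw [← hreflect b _ _ (hlt₁ u hu) (hlt₁ v hv)]
        push_cast
        ring_nf
    have f₃ : arrangementCost p₀ (fun w => a - 1 - q₀ w) = arrangementCost p₀ q₀ :=
      arrangementCost_congr fun u v hu hv => hreflect a _ _ (hlt₀ u hu) (hlt₀ v hv)
    have hcross : (∑ w, if p₀ w && p₁ w then |(q₀ w : ℤ) - ((a + q₁ w : ℕ) : ℤ)| else 0) +
        (∑ w, if p₀ w && p₁ w then
          |((a - 1 - q₀ w : ℕ) : ℤ) - ((a + (b - 1 - q₁ w) : ℕ) : ℤ)| else 0) =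
        volume (fun w => p₀ w && p₁ w) * (a + b) := by
      rw [← sum_add_distrib, volume, card_filter]
      push_cast
      rw [sum_mul]
      refine sum_congr rfl fun w _ => ?_
      by_cases hw : (p₀ w && p₁ w) = true
      · rw [if_pos hw, if_pos hw, if_pos hw]
        rw [Bool.and_eq_true] at hw
        have := hlt₀ w hw.1
        have := hlt₁ w hw.2
        rw [abs_of_nonpos (by omega), abs_of_nonpos (by omega)]
        omega
      · rw [if_neg hw, if_neg hw, if_neg hw]
        ring
    have hca : volume (fun w => p₀ w && p₁ w) ≤ a := volume_mono fun v hv => by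
      rw [Bool.and_eq_true] at hv
      exact hv.1
    have hcb : volume (fun w => p₀ w && p₁ w) ≤ b := volume_mono fun v hv => by
      rw [Bool.and_eq_true] at hv
      exact hv.2
    have hbound : (volume (fun w => p₀ w && p₁ w) * (a + b) : ℤ) ≤ 2 * (a * b) := by
      have h₁ := Nat.mul_le_mul_right b hca
      have h₂ := Nat.mul_le_mul_right a hcb
      have h₃ : (volume (fun w => p₀ w && p₁ w) : ℤ) * b ≤ a * b := by exact_mod_cast h₁
      have h₄ : (volume (fun w => p₀ w && p₁ w) : ℤ) * a ≤ b * a := by exact_mod_cast h₂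
      linarith
    by_cases hchoice : arrangementCost p (glue q₀ fun w => a + q₁ w) ≤
        (volume p : ℤ) ^ 2 - volume p
    · exact key q₀ q₁ hlt₀ hlt₁ hinj₀ hinj₁ hchoice
    · refine key (fun w => a - 1 - q₀ w) (fun w => b - 1 - q₁ w) ?_ ?_ ?_ ?_ ?_
      · intro w hw
        have := hlt₀ w hw
        omega
      · intro w hw
        have := hlt₁ w hw
        omega
      · intro u v hu hv huv
        have := hlt₀ u hu
        have := hlt₀ v hv
        exact hinj₀ u v hu hv (by omega)
      · intro u v hu hv huv
        have := hlt₁ u hu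
        have := hlt₁ v hv
        exact hinj₁ u v hu hv (by omega)
      · rw [hv] at hchoice ⊢
        push_cast at hchoice ⊢
        rw [e₁, f₁] at hchoice
        rw [e₂, f₂, f₃]
        push_cast at hcross hchoice ⊢
        nlinarith

/-- Lower bounds for bijective embeddings pass to maps with fibers of constant size. -/
lemma le_edgeSum_of_bijective {n K R : ℕ} (hR : 0 < R) {g : (Fin n → Bool) → ℕ}
    (hg : ∀ v, 1 ≤ g v ∧ g v ≤ K) (hfib : ∀ a, 1 ≤ a → a ≤ K → volume (fun v => g v == a) = R)
    {d D : ℕ → ℕ → ℤ} {L : ℤ}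
    (hL : ∀ H : (Fin n → Bool) → ℕ, Function.Injective H → (∀ v, 1 ≤ H v ∧ H v ≤ K * R) →
      L ≤ edgeSum fun u v => D (H u) (H v))
    (hd : ∀ a b x y, a < K → b < K → x < R → y < R →
      D (R * a + x + 1) (R * b + y + 1) + D (R * a + (R - x)) (R * b + (R - y)) ≤
        2 * (R * d (a + 1) (b + 1) + if a = b then |(x : ℤ) - y| else 0)) :
    L ≤ R * edgeSum (fun u v => d (g u) (g v)) + K * ((R : ℤ) ^ 2 - R) := by
  choose q hlt hinj hcost using fun a => exists_arrangement fun v : Fin n → Bool => g v == a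
  have hlt' : ∀ v, q (g v) v < R := fun v => by
    have := hlt (g v) v (by simp)
    rwa [hfib _ (hg v).1 (hg v).2] at this
  have hdiv : ∀ a b x y, x < R → y < R → R * a + x = R * b + y → a = b ∧ x = y := by
    intro a b x y hx hy h
    have h₁ : (R * a + x) / R = a := by
      rw [Nat.mul_add_div hR, Nat.div_eq_of_lt hx, add_zero]
    have h₂ : (R * b + y) / R = b := by
      rw [Nat.mul_add_div hR, Nat.div_eq_of_lt hy, add_zero]
    have : a = b := by rw [← h₁, h, h₂]
    subst this
    exact ⟨rfl, by omega⟩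
  have hmem : ∀ v, R * (g v - 1) + R ≤ K * R := by
    intro v
    have := Nat.mul_le_mul_left R (hg v).2
    have h₁ : R * (g v - 1) + R = R * g v := by
      obtain ⟨c, hc⟩ := Nat.exists_eq_add_of_le (hg v).1
      rw [hc, Nat.add_sub_cancel_left]
      ring
    rw [h₁, mul_comm K]
    exact this
  have hsep : ∀ u v, g u - 1 = g v - 1 ∧ q (g u) u = q (g v) v → u = v := by
    rintro u v ⟨h₁, h₂⟩
    have h₃ : g u = g v := by
      have := hg u
      have := hg v
      omega
    rw [h₃] at h₂
    exact hinj (g v) u v (by simpa using h₃) (by simp) h₂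
  have h₁ := hL (fun v => R * (g v - 1) + q (g v) v + 1)
    (fun u v huv => hsep u v (hdiv _ _ _ _ (hlt' u) (hlt' v) (by simpa using huv)))
    (fun v => by
      have := hmem v
      have := hlt' v
      omega)
  have h₂ := hL (fun v => R * (g v - 1) + (R - q (g v) v))
    (fun u v huv => by
      have h₃ := hlt' u
      have h₄ := hlt' v
      have h₅ := hdiv (g u - 1) (g v - 1) (R - 1 - q (g u) u) (R - 1 - q (g v) v) (by omega)
        (by omega) (by
          simp only at huv
          omega)
      exact hsep u v ⟨h₅.1, by omega⟩)
    (fun v => by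
      have := hmem v
      have := hlt' v
      omega)
  have h₃ := add_le_add h₁ h₂
  rw [← edgeSum_add] at h₃
  have h₄ : edgeSum (fun u v => if g u = g v then |(q (g u) u : ℤ) - q (g v) v| else 0) ≤
      K * ((R : ℤ) ^ 2 - R) := by
    have h₅ : edgeSum (fun u v => if g u = g v then |(q (g u) u : ℤ) - q (g v) v| else 0) =
        ∑ a ∈ Icc 1 K, arrangementCost (fun v => g v == a) (q a) := by
      simp only [arrangementCost]
      rw [← edgeSum_sum]
      congr 1
      funext u v
      rw [sum_eq_single (g u)]
      · by_cases h : g u = g v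
        · simp [h]
        · simp [h, Ne.symm h]
      · intro a _ ha
        simp [ha.symm]
      · intro h
        exact absurd (mem_Icc.2 (hg u)) h
    rw [h₅]
    refine (sum_le_sum fun a ha => hcost a).trans (le_of_eq ?_)
    rw [sum_congr rfl fun a ha => by
      rw [hfib a (mem_Icc.1 ha).1 (mem_Icc.1 ha).2], sum_const, Nat.card_Icc]
    simp
  have h₅ : edgeSum (fun u v => D (R * (g u - 1) + q (g u) u + 1) (R * (g v - 1) + q (g v) v + 1) +
      D (R * (g u - 1) + (R - q (g u) u)) (R * (g v - 1) + (R - q (g v) v))) ≤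
      2 * (R * edgeSum (fun u v => d (g u) (g v)) +
        edgeSum (fun u v => if g u = g v then |(q (g u) u : ℤ) - q (g v) v| else 0)) := by
    rw [← edgeSum_mul_left, ← edgeSum_add, ← edgeSum_mul_left]
    refine edgeSum_le_edgeSum fun u v => ?_
    have hu := hg u
    have hv := hg v
    have := hd (g u - 1) (g v - 1) _ _ (by omega) (by omega) (hlt' u) (hlt' v)
    rw [Nat.sub_add_cancel hu.1, Nat.sub_add_cancel hv.1] at this
    have h : g u - 1 = g v - 1 ↔ g u = g v := by omega
    simpa only [h] using this
  linarith

lemma dist_blocks_le {R : ℕ} {a b x y : ℕ} (hx : x < R) (hy : y < R) :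
    (Nat.dist (R * a + x + 1) (R * b + y + 1) + Nat.dist (R * a + (R - x)) (R * b + (R - y)) : ℤ) ≤
      2 * (R * (Nat.dist (a + 1) (b + 1) : ℤ) + if a = b then |(x : ℤ) - y| else 0) := by
  wlog hab : a ≤ b generalizing a b x y
  · have h := this hy hx (by omega : b ≤ a)
    rw [Nat.dist_comm (R * b + y + 1), Nat.dist_comm (R * b + (R - y)), Nat.dist_comm (b + 1),
      abs_sub_comm] at h
    simpa only [eq_comm] using h
  obtain ⟨δ, rfl⟩ := Nat.exists_eq_add_of_le hab
  have h₁ : Nat.dist (a + 1) (a + δ + 1) = δ := by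
    rw [Nat.dist_eq_sub_of_le (by omega)]
    omega
  rw [h₁]
  rcases Nat.eq_zero_or_pos δ with rfl | hδ
  · have h₂ := le_abs_self ((x : ℤ) - y)
    have h₃ := neg_le_abs ((x : ℤ) - y)
    simp only [Nat.dist, add_zero, if_true, Nat.cast_zero, mul_zero, zero_add]
    omega
  · have h₂ : R * 1 ≤ R * δ := Nat.mul_le_mul_left R hδ
    rw [if_neg (by omega), mul_add]
    have h₃ : (R : ℤ) * δ = ((R * δ : ℕ) : ℤ) := by push_cast; ring
    rw [h₃]
    simp only [Nat.dist]
    omega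

lemma cycDist_blocks_le {K R : ℕ} {a b x y : ℕ} (ha : a < K) (hb : b < K) (hx : x < R)
    (hy : y < R) :
    (cycDist (K * R) (R * a + x + 1) (R * b + y + 1) +
      cycDist (K * R) (R * a + (R - x)) (R * b + (R - y)) : ℤ) ≤
      2 * (R * (cycDist K (a + 1) (b + 1) : ℤ) + if a = b then |(x : ℤ) - y| else 0) := by
  wlog hab : a ≤ b generalizing a b x y
  · have h := this hb ha hy hx (by omega : b ≤ a)
    simp only [cycDist] at h ⊢
    rw [Nat.dist_comm (R * b + y + 1), Nat.dist_comm (R * b + (R - y)), Nat.dist_comm (b + 1),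
      abs_sub_comm] at h
    simpa only [eq_comm] using h
  obtain ⟨δ, rfl⟩ := Nat.exists_eq_add_of_le hab
  have h₁ : Nat.dist (a + 1) (a + δ + 1) = δ := by
    rw [Nat.dist_eq_sub_of_le (by omega)]
    omega
  simp only [cycDist]
  rw [h₁]
  rcases Nat.eq_zero_or_pos δ with rfl | hδ
  · have h₂ := le_abs_self ((x : ℤ) - y)
    have h₃ := neg_le_abs ((x : ℤ) - y)
    simp only [Nat.dist, add_zero, if_true, Nat.zero_min, Nat.cast_zero, mul_zero, zero_add]
    omega
  · have h₂ : R * 1 ≤ R * δ := Nat.mul_le_mul_left R hδ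
    rw [if_neg (by omega), mul_add]
    have h₃ : (R : ℤ) * (min δ (K - δ) : ℕ) = (min (R * δ) (K * R - R * δ) : ℕ) := by
      rw [mul_comm K, ← Nat.mul_sub, Nat.mul_min_mul_left, Nat.cast_mul]
    have h₄ : R * (δ + 1) ≤ R * K := Nat.mul_le_mul_left R (by omega)
    rw [mul_add, mul_comm R K] at h₄
    rw [h₃]
    simp only [Nat.dist]
    omega

/-- The wirelength bound for maps from the cube to the path with fibers of constant size. -/
lemma le_edgeSum_dist_of_fibers {n m r : ℕ} (hn : n = m + r) {g : (Fin n → Bool) → ℕ}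
    (hg : ∀ v, 1 ≤ g v ∧ g v ≤ 2 ^ m)
    (hfib : ∀ a, 1 ≤ a → a ≤ 2 ^ m → volume (fun v => g v == a) = 2 ^ r) :
    (2 : ℤ) ^ r * ((2 ^ m) ^ 2 - 2 ^ m) ≤ edgeSum fun u v => (Nat.dist (g u) (g v) : ℤ) := by
  have hKR : 2 ^ m * 2 ^ r = 2 ^ n := by rw [hn, pow_add]
  have key := le_edgeSum_of_bijective (d := fun a b => (Nat.dist a b : ℤ))
    (D := fun a b => (Nat.dist a b : ℤ)) (by positivity) hg hfib
    (fun H hinj hmem => le_edgeSum_dist hKR hinj hmem)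
    (fun a b x y _ _ hx hy => dist_blocks_le hx hy)
  push_cast at key
  have hpos : (0 : ℤ) < 2 ^ r := by positivity
  refine le_of_mul_le_mul_left ?_ hpos
  linarith

/-- The wirelength bound for maps from the cube to the cycle with fibers of constant size. -/
lemma le_edgeSum_cycDist_of_fibers {n m r : ℕ} (hn : n = m + 2 + r) {g : (Fin n → Bool) → ℕ}
    (hg : ∀ v, 1 ≤ g v ∧ g v ≤ 2 ^ (m + 2))
    (hfib : ∀ a, 1 ≤ a → a ≤ 2 ^ (m + 2) → volume (fun v => g v == a) = 2 ^ r) :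
    (2 : ℤ) ^ r * (12 * (2 ^ m) ^ 2 - 4 * 2 ^ m) ≤
      edgeSum fun u v => (cycDist (2 ^ (m + 2)) (g u) (g v) : ℤ) := by
  obtain rfl : n = m + r + 2 := by omega
  have hKR : 2 ^ (m + 2) * 2 ^ r = 4 * 2 ^ (m + r) := by ring
  have key := le_edgeSum_of_bijective (d := fun a b => (cycDist (2 ^ (m + 2)) a b : ℤ))
    (D := fun a b => (cycDist (2 ^ (m + 2) * 2 ^ r) a b : ℤ)) (by positivity) hg hfib
    (fun H hinj hmem => by
      rw [hKR] at hmem ⊢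
      exact le_edgeSum_cycDist rfl hinj hmem)
    (fun a b x y ha hb hx hy => cycDist_blocks_le ha hb hx hy)
  push_cast at key
  have hpos : (0 : ℤ) < 2 ^ r := by positivity
  refine le_of_mul_le_mul_left ?_ hpos
  have h₁ : (2 : ℤ) ^ (m + 2) = 4 * 2 ^ m := by ring
  rw [pow_add 2 m r, h₁] at key
  linarith

lemma gray_insertBit {n : ℕ} (b : Bool) (w : Fin n → Bool) :
    gray (n + 1) (insertBit 0 b w) = if b then 2 ^ (n + 1) + 1 - gray n w else gray n w := by
  cases b <;> simp [gray, insertBit]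

lemma exists_eq_insertBit {n : ℕ} (v : Fin (n + 1) → Bool) : ∃ b w, v = insertBit 0 b w :=
  ⟨v 0, Fin.tail v, by simp [insertBit]⟩

lemma gray_mem {n : ℕ} (v : Fin n → Bool) : 1 ≤ gray n v ∧ gray n v ≤ 2 ^ n := by
  induction n with
  | zero => simp [gray]
  | succ n ih =>
    obtain ⟨b, w, rfl⟩ := exists_eq_insertBit v
    have := ih w
    rw [gray_insertBit, pow_succ]
    split_ifs <;> omega

lemma gray_injective (n : ℕ) : Function.Injective (gray n) := by
  induction n with
  | zero => exact fun u v _ => Subsingleton.elim _ _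
  | succ n ih =>
    intro u v h
    obtain ⟨b, w, rfl⟩ := exists_eq_insertBit u
    obtain ⟨c, w', rfl⟩ := exists_eq_insertBit v
    have h₁ := gray_mem w
    have h₂ := gray_mem w'
    rw [gray_insertBit, gray_insertBit, pow_succ] at h
    cases b <;> cases c <;> simp only [if_true, if_false, Bool.false_eq_true] at h
    · rw [ih h]
    · omega
    · omega
    · rw [ih (by omega : gray n w = gray n w')]

lemma exists_gray_eq {n x : ℕ} (h₁ : 1 ≤ x) (h₂ : x ≤ 2 ^ n) : ∃ v, gray n v = x := by
  induction n generalizing x with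
  | zero => exact ⟨Fin.elim0, by simp only [gray]; omega⟩
  | succ n ih =>
    rw [pow_succ] at h₂
    by_cases hx : x ≤ 2 ^ n
    · obtain ⟨w, rfl⟩ := ih h₁ hx
      exact ⟨insertBit 0 false w, by rw [gray_insertBit]; simp⟩
    · obtain ⟨w, hw⟩ := ih (x := 2 ^ (n + 1) + 1 - x) (by omega) (by omega)
      refine ⟨insertBit 0 true w, ?_⟩
      rw [gray_insertBit, hw, if_pos rfl]
      omega

lemma two_mul_sum_gray (n : ℕ) : 2 * ∑ v, (gray n v : ℤ) = 2 ^ n * (2 ^ n + 1) := by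
  cases n with
  | zero => simp [gray]
  | succ n =>
    rw [sum_insertBit 0, ← sum_add_distrib]
    have h : ∀ w : Fin n → Bool, (gray (n + 1) (insertBit 0 false w) : ℤ) +
        gray (n + 1) (insertBit 0 true w) = 2 ^ (n + 1) + 1 := by
      intro w
      have := gray_mem w
      rw [gray_insertBit, gray_insertBit, if_neg (by simp), if_pos rfl, Nat.cast_sub]
      · push_cast
        ring
      · rw [pow_succ]
        omega
    simp only [h, sum_const, card_univ, Fintype.card_fun, Fintype.card_bool, Fintype.card_fin,
      nsmul_eq_mul]
    push_cast
    ring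

lemma edgeSum_dist_gray (n : ℕ) :
    edgeSum (fun u v => (Nat.dist (gray n u) (gray n v) : ℤ)) = (2 ^ n) ^ 2 - 2 ^ n := by
  induction n with
  | zero => simp [edgeSum]
  | succ n ih =>
    rw [edgeSum_insertBit 0]
    have h₁ : ∀ u v : Fin n → Bool, Nat.dist (gray (n + 1) (insertBit 0 true u))
        (gray (n + 1) (insertBit 0 true v)) = Nat.dist (gray n u) (gray n v) := by
      intro u v
      have := gray_mem u
      have := gray_mem v
      simp only [gray_insertBit, if_true, Nat.dist, pow_succ]
      omega
    have h₂ : ∀ u v : Fin n → Bool, Nat.dist (gray (n + 1) (insertBit 0 false u))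
        (gray (n + 1) (insertBit 0 false v)) = Nat.dist (gray n u) (gray n v) := by
      intro u v
      simp only [gray_insertBit, Bool.false_eq_true, if_false]
    have h₃ : ∀ w : Fin n → Bool, (Nat.dist (gray (n + 1) (insertBit 0 false w))
        (gray (n + 1) (insertBit 0 true w)) : ℤ) + Nat.dist (gray (n + 1) (insertBit 0 true w))
        (gray (n + 1) (insertBit 0 false w)) = 2 * (2 * 2 ^ n + 1) - 2 * (2 * gray n w) := by
      intro w
      have := gray_mem w
      have h : (2 : ℤ) ^ n = (2 ^ n : ℕ) := by norm_cast
      simp only [gray_insertBit, if_true, Bool.false_eq_true, if_false, Nat.dist, pow_succ, h]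
      omega
    simp only [h₁, h₂, h₃, ih, sum_sub_distrib, ← mul_sum, two_mul_sum_gray, sum_const, card_univ,
      Fintype.card_fun, Fintype.card_bool, Fintype.card_fin, nsmul_eq_mul]
    push_cast
    ring

lemma edgeSum_cycDist_gray (n : ℕ) :
    edgeSum (fun u v => (cycDist (2 ^ (n + 2)) (gray (n + 2) u) (gray (n + 2) v) : ℤ)) =
      12 * (2 ^ n) ^ 2 - 4 * 2 ^ n := by
  rw [edgeSum_insertBit 0]
  have h₁ : ∀ u v : Fin (n + 1) → Bool, cycDist (2 ^ (n + 2))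
      (gray (n + 2) (insertBit 0 true u)) (gray (n + 2) (insertBit 0 true v)) =
      Nat.dist (gray (n + 1) u) (gray (n + 1) v) := by
    intro u v
    have := gray_mem u
    have := gray_mem v
    have : 2 ^ (n + 2) = 2 * 2 ^ (n + 1) := by ring
    simp only [gray_insertBit, if_true, cycDist, Nat.dist]
    omega
  have h₂ : ∀ u v : Fin (n + 1) → Bool, cycDist (2 ^ (n + 2))
      (gray (n + 2) (insertBit 0 false u)) (gray (n + 2) (insertBit 0 false v)) =
      Nat.dist (gray (n + 1) u) (gray (n + 1) v) := by
    intro u v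
    have := gray_mem u
    have := gray_mem v
    have : 2 ^ (n + 2) = 2 * 2 ^ (n + 1) := by ring
    simp only [gray_insertBit, if_false, Bool.false_eq_true, cycDist, Nat.dist]
    omega
  have h₃ : ∀ (b : Bool) (w : Fin n → Bool),
      (cycDist (2 ^ (n + 2)) (gray (n + 2) (insertBit 0 false (insertBit 0 b w)))
        (gray (n + 2) (insertBit 0 true (insertBit 0 b w))) : ℤ) +
      cycDist (2 ^ (n + 2)) (gray (n + 2) (insertBit 0 true (insertBit 0 b w)))
        (gray (n + 2) (insertBit 0 false (insertBit 0 b w))) = 2 * (2 * gray n w) - 2 := by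
    intro b w
    have := gray_mem w
    have : 2 ^ (n + 2) = 4 * 2 ^ n := by ring
    have : 2 ^ (n + 1) = 2 * 2 ^ n := by ring
    simp only [gray_insertBit, if_true, Bool.false_eq_true, if_false, cycDist, Nat.dist]
    cases b <;> simp only [if_true, Bool.false_eq_true, if_false] <;> omega
  rw [sum_insertBit 0]
  simp only [h₁, h₂, h₃, edgeSum_dist_gray, sum_sub_distrib, ← mul_sum, two_mul_sum_gray, sum_const,
    card_univ, Fintype.card_fun, Fintype.card_bool, Fintype.card_fin, nsmul_eq_mul]
  push_cast
  ring

section Blocks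

variable {k : ℕ} (n : Fin k → ℕ)

lemma blockOffset_add_le {i j : Fin k} (h : i < j) : blockOffset n i + n i ≤ blockOffset n j := by
  have h₁ : blockOffset n i + n i =
      ∑ l ∈ insert i (Finset.univ.filter (fun l => l < i)), n l := by
    rw [sum_insert (by simp), Nat.add_comm]
    rfl
  rw [h₁]
  refine sum_le_sum_of_subset fun l hl => ?_
  simp only [mem_insert, mem_filter, mem_univ, true_and] at hl ⊢
  rcases hl with rfl | hl
  · exact h
  · exact hl.trans h

lemma blockPos_bijective :
    Function.Bijective fun p : (i : Fin k) × Fin (n i) => blockPos n p.1 p.2 := by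
  refine (Fintype.bijective_iff_injective_and_card _).2 ⟨?_, by simp⟩
  rintro ⟨i, s⟩ ⟨j, t⟩ h
  have h' : blockOffset n i + (s : ℕ) = blockOffset n j + (t : ℕ) := congrArg Fin.val h
  have hs := s.isLt
  have ht := t.isLt
  rcases lt_trichotomy i j with hij | rfl | hij
  · have := blockOffset_add_le n hij
    omega
  · obtain rfl : s = t := Fin.ext (by omega)
    rfl
  · have := blockOffset_add_le n hij
    omega

lemma split_bijective : Function.Bijective (split n) := by
  refine (Fintype.bijective_iff_injective_and_card _).2 ⟨?_, ?_⟩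
  · intro u v h
    funext p
    obtain ⟨⟨i, t⟩, rfl⟩ := (blockPos_bijective n).2 p
    exact congrFun (congrFun h i) t
  · simp [Fintype.card_pi, prod_pow_eq_pow_sum]

lemma block_flipAt_same (i : Fin k) (t : Fin (n i)) (v : Fin (∑ j, n j) → Bool) :
    block n (flipAt (blockPos n i t) v) i = flipAt t (block n v i) := by
  funext s
  by_cases h : s = t
  · subst h
    simp [block, flipAt_same]
  · have : blockPos n i s ≠ blockPos n i t := fun h' => h (by
      have := (blockPos_bijective n).1 (a₁ := ⟨i, s⟩) (a₂ := ⟨i, t⟩) h'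
      simpa using this)
    simp [block, flipAt_of_ne h, flipAt_of_ne this]

lemma block_flipAt_of_ne {i j : Fin k} (h : j ≠ i) (t : Fin (n j)) (v : Fin (∑ j, n j) → Bool) :
    block n (flipAt (blockPos n j t) v) i = block n v i := by
  funext s
  refine flipAt_of_ne (fun h' => h ?_) v
  have := (blockPos_bijective n).1 (a₁ := ⟨i, s⟩) (a₂ := ⟨j, t⟩) h'
  exact (congrArg Sigma.fst this).symm

lemma prod_erase_two_pow (i : Fin k) :
    ∏ j ∈ univ.erase i, 2 ^ n j = 2 ^ ((∑ j, n j) - n i) := by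
  rw [prod_pow_eq_pow_sum, ← add_sum_erase univ n (mem_univ i), Nat.add_sub_cancel_left]

lemma sum_block (i : Fin k) (φ : (Fin (n i) → Bool) → ℤ) :
    ∑ v, φ (block n v i) = 2 ^ ((∑ j, n j) - n i) * ∑ w, φ w := by
  have h₁ : ∑ v, φ (block n v i) = ∑ y : (j : Fin k) → Fin (n j) → Bool, φ (y i) :=
    (split_bijective n).sum_comp fun y => φ (y i)
  have h₂ : ∀ w, #{y : (j : Fin k) → Fin (n j) → Bool | y i = w} = 2 ^ ((∑ j, n j) - n i) := by
    intro w
    have h := Fintype.card_filter_piFinset_eq_of_mem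
      (fun j => (univ : Finset (Fin (n j) → Bool))) i (mem_univ w)
    rw [Fintype.piFinset_univ] at h
    rw [h, ← prod_erase_two_pow]
    simp
  rw [h₁, ← sum_fiberwise (s := univ) (g := fun y : (j : Fin k) → Fin (n j) → Bool => y i),
    mul_sum]
  refine sum_congr rfl fun w _ => ?_
  rw [sum_congr rfl fun y hy => congrArg φ (mem_filter.1 hy).2, sum_const, h₂, nsmul_eq_mul]
  push_cast
  rfl

lemma edgeSum_block (i : Fin k) {G : (Fin (n i) → Bool) → (Fin (n i) → Bool) → ℤ}
    (hG : ∀ w, G w w = 0) :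
    edgeSum (fun u v => G (block n u i) (block n v i)) =
      2 ^ ((∑ j, n j) - n i) * edgeSum G := by
  rw [edgeSum, edgeSum, ← sum_block]
  refine sum_congr rfl fun v _ => ?_
  rw [← (blockPos_bijective n).sum_comp, Fintype.sum_sigma, sum_eq_single i]
  · simp only [block_flipAt_same]
  · intro j _ hj
    simp only [block_flipAt_of_ne n hj, hG, sum_const_zero]
  · exact fun h => absurd (mem_univ i) h

lemma grayK_bijOn :
    Set.BijOn (grayK n) Set.univ {x : Fin k → ℕ | ∀ i, x i ∈ Set.Icc 1 (2 ^ n i)} := by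
  refine ⟨fun v _ i => gray_mem _, fun u _ v _ h => (split_bijective n).1 ?_, fun x hx => ?_⟩
  · funext i
    exact gray_injective _ (congrFun h i)
  · choose w hw using fun i => exists_gray_eq (hx i).1 (hx i).2
    obtain ⟨v, rfl⟩ := (split_bijective n).2 w
    exact ⟨v, Set.mem_univ v, funext hw⟩

lemma volume_fiber_of_bijOn {f : (Fin (∑ j, n j) → Bool) → (Fin k → ℕ)}
    (hf : Set.BijOn f Set.univ {x : Fin k → ℕ | ∀ i, x i ∈ Set.Icc 1 (2 ^ n i)}) (i : Fin k)
    {a : ℕ} (h₁ : 1 ≤ a) (h₂ : a ≤ 2 ^ n i) :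
    volume (fun v => f v i == a) = 2 ^ ((∑ j, n j) - n i) := by
  have himage : univ.image f = Fintype.piFinset fun j => Icc 1 (2 ^ n j) := by
    ext x
    have := Set.ext_iff.1 hf.image_eq x
    simpa using this
  have h := Fintype.card_filter_piFinset_eq_of_mem (fun j => Icc 1 (2 ^ n j)) i
    (mem_Icc.2 ⟨h₁, h₂⟩)
  rw [← himage, filter_image, card_image_of_injective _ (Set.injOn_univ.1 hf.injOn)]
    at h
  simp only [Nat.card_Icc, Nat.add_sub_cancel, prod_erase_two_pow] at h
  simpa [volume] using h

end Blocks

lemma wirelength_eq {n : ℕ} {α : Type*} (d : α → α → ℕ) (f : (Fin n → Bool) → α) :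
    wirelength d f = edgeSum (fun u v => d (f u) (f v)) / 2 := by
  rw [wirelength, sum_cubeAdj fun u v => d (f u) (f v)]

lemma edgeSum_prodDist {k N : ℕ} (c : Fin k → Bool) (n : Fin k → ℕ)
    (f : (Fin N → Bool) → Fin k → ℕ) :
    ((edgeSum fun u v => prodDist c n (f u) (f v) : ℕ) : ℤ) =
      ∑ i, edgeSum fun u v => ((if c i then cycDist (2 ^ n i) (f u i) (f v i)
        else Nat.dist (f u i) (f v i) : ℕ) : ℤ) := by
  rw [← edgeSum_sum]
  simp only [edgeSum, prodDist]
  push_cast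
  rfl

/-- The optimal wirelength in one factor of the product. -/
lemma two_mul_factor {m r : ℕ} (hm : 2 ≤ m) (b : Bool) :
    ((2 * (if b then 2 ^ r * (3 * 2 ^ (2 * m - 3) - 2 ^ (m - 1))
      else 2 ^ r * (2 ^ (2 * m - 1) - 2 ^ (m - 1))) : ℕ) : ℤ) =
      2 ^ r * if b then 12 * (2 ^ (m - 2)) ^ 2 - 4 * 2 ^ (m - 2) else (2 ^ m) ^ 2 - 2 ^ m := by
  obtain ⟨l, rfl⟩ := Nat.exists_eq_add_of_le hm
  have e₁ : 2 * (2 + l) - 3 = l + l + 1 := by omega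
  have e₂ : 2 + l - 1 = l + 1 := by omega
  have e₃ : 2 * (2 + l) - 1 = l + l + 3 := by omega
  have hle : ∀ a b : ℕ, a ≤ b → 2 ^ a ≤ 2 ^ b := fun a b h =>
    Nat.pow_le_pow_right (by norm_num) h
  rw [e₁, e₂, e₃, Nat.add_sub_cancel_left]
  cases b
  · rw [if_neg (by simp), if_neg (by simp), Nat.cast_mul, Nat.cast_mul, Nat.cast_sub
      (hle _ _ (by omega))]
    push_cast
    ring
  · have h := hle (l + 1) (l + l + 1) (by omega)
    rw [if_pos rfl, if_pos rfl, Nat.cast_mul, Nat.cast_mul, Nat.cast_sub (by omega)]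
    push_cast
    ring

/-- Minimum wirelength of the hypercube into a Cartesian product of paths and/or
cycles, achieved by the `k`-order Gray code embedding. -/
theorem stmt14 (k : ℕ) (hk : 1 ≤ k) (n : Fin k → ℕ) (hn : ∀ i, 2 ≤ n i)
    (c : Fin k → Bool) :
    (∀ f : (Fin (∑ j, n j) → Bool) → (Fin k → ℕ),
      Set.BijOn f Set.univ {x : Fin k → ℕ | ∀ i, x i ∈ Set.Icc 1 (2 ^ n i)} →
      (∑ i, if c i then 2 ^ ((∑ j, n j) - n i) * (3 * 2 ^ (2 * n i - 3) - 2 ^ (n i - 1))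
            else 2 ^ ((∑ j, n j) - n i) * (2 ^ (2 * n i - 1) - 2 ^ (n i - 1))) ≤
        wirelength (prodDist c n) f) ∧
    Set.BijOn (grayK n) Set.univ {x : Fin k → ℕ | ∀ i, x i ∈ Set.Icc 1 (2 ^ n i)} ∧
    wirelength (prodDist c n) (grayK n) =
      ∑ i, if c i then 2 ^ ((∑ j, n j) - n i) * (3 * 2 ^ (2 * n i - 3) - 2 ^ (n i - 1))
           else 2 ^ ((∑ j, n j) - n i) * (2 ^ (2 * n i - 1) - 2 ^ (n i - 1)) := by
  have hfactor := fun i => two_mul_factor (r := (∑ j, n j) - n i) (hn i) (c i)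
  have hle : ∀ i, n i ≤ ∑ j, n j := fun i => single_le_sum (fun _ _ => Nat.zero_le _) (mem_univ i)
  refine ⟨fun f hf => ?_, grayK_bijOn n, ?_⟩
  · rw [wirelength_eq, Nat.le_div_iff_mul_le two_pos, mul_comm, mul_sum]
    zify
    rw [edgeSum_prodDist]
    refine sum_le_sum fun i _ => ?_
    have h := hfactor i
    push_cast at h ⊢
    rw [h]
    have hg : ∀ v, 1 ≤ f v i ∧ f v i ≤ 2 ^ n i := fun v => hf.mapsTo (Set.mem_univ v) i
    have hfib := fun a h₁ h₂ => volume_fiber_of_bijOn n hf i (a := a) h₁ h₂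
    cases hc : c i
    · have hN : ∑ j, n j = n i + ((∑ j, n j) - n i) := by
        have := hle i
        omega
      simpa using le_edgeSum_dist_of_fibers hN hg hfib
    · obtain ⟨l, hl⟩ := Nat.exists_eq_add_of_le' (hn i)
      have hN : ∑ j, n j = l + 2 + ((∑ j, n j) - n i) := by
        have := hle i
        omega
      have h' := le_edgeSum_cycDist_of_fibers hN (by rwa [← hl]) (by rwa [← hl])
      rw [← hl] at h'
      have hl' : n i - 2 = l := by omega
      simpa [hl'] using h'
  · rw [wirelength_eq]
    refine Nat.div_eq_of_eq_mul_right two_pos ?_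
    rw [mul_sum]
    zify
    rw [edgeSum_prodDist]
    refine sum_congr rfl fun i _ => ?_
    have h := hfactor i
    push_cast at h ⊢
    rw [h]
    simp only [grayK]
    cases hc : c i
    · have h' := edgeSum_block n i (G := fun u v => (Nat.dist (gray (n i) u) (gray (n i) v) : ℤ))
        (by simp)
      rw [edgeSum_dist_gray] at h'
      simpa using h'
    · have h' := edgeSum_block n i
        (G := fun u v => (cycDist (2 ^ n i) (gray (n i) u) (gray (n i) v) : ℤ)) (by simp [cycDist])
      have h'' : edgeSum (fun u v => (cycDist (2 ^ n i) (gray (n i) u) (gray (n i) v) : ℤ)) =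
          12 * (2 ^ (n i - 2)) ^ 2 - 4 * 2 ^ (n i - 2) := by
        have h₂ := edgeSum_cycDist_gray (n i - 2)
        rwa [Nat.sub_add_cancel (hn i)] at h₂
      rw [h''] at h'
      simpa using h'
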